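/- Fix an integer n > 1. Among the φ(n) + 1 real numbers consisting of the Euler–Mascheroni constant γ together with the values ψ(r/n) for all integers r with 1 ≤ r ≤ n and gcd(r, n) = 1, at most one is algebraic (i.e., there do not exist two distinct members of this collection that are both algebraic over ℚ). -/

import Mathlib

/-- The digamma function `ψ(x) = -γ - 1/x + ∑_{n=1}^∞ (1/n - 1/(n+x))` for real `x`. -/
noncomputable def digamma (x : ℝ) : ℝ :=
  -Real.eulerMascheroniConstant - 1 / x +
    ∑' k : ℕ, (1 / ((k : ℝ) + 1) - 1 / (((k : ℝ) + 1) + x))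

/-- The collection consisting of `γ` together with the values `ψ(r/n)` for
`1 ≤ r ≤ n`, `gcd(r, n) = 1`. -/
def digammaSet (n : ℕ) : Set ℝ :=
  {Real.eulerMascheroniConstant} ∪
    {x : ℝ | ∃ r : ℕ, 1 ≤ r ∧ r ≤ n ∧ Nat.gcd r n = 1 ∧ x = digamma ((r : ℝ) / (n : ℝ))}

open Complex in
/-- An entire function vanishing on a multiset of points is divisible by the corresponding
product of linear factors. -/
theorem exists_entire_eq_prod_mul (s : Multiset ℂ) :
    ∀ f : ℂ → ℂ, Differentiable ℂ f → (∀ c, (s.count c : ℕ∞) ≤ analyticOrderAt f c) →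
      ∃ q : ℂ → ℂ, Differentiable ℂ q ∧ ∀ z, f z = (s.map (fun c => z - c)).prod * q z := by
  induction s using Multiset.induction_on with
  | empty => exact fun f hf _ => ⟨f, hf, fun z => by simp⟩
  | cons c s ih =>
    intro f hf hord
    have hfc : f c = 0 := by
      apply apply_eq_zero_of_analyticOrderAt_ne_zero
      intro h0
      have := hord c
      rw [h0, Multiset.count_cons_self] at this
      simp at this
    have hg : Differentiable ℂ (dslope f c) := by
      rw [← differentiableOn_univ]
      exact (Complex.differentiableOn_dslope Filter.univ_mem).2 hf.differentiableOn
    have hfg : ∀ z, f z = (z - c) * dslope f c z := fun z => by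
      have := sub_smul_dslope f c z
      rw [hfc, sub_zero, smul_eq_mul] at this
      exact this.symm
    have hlin : ∀ z, AnalyticAt ℂ (fun z : ℂ => z - c) z := fun z => by fun_prop
    have horder : ∀ z, analyticOrderAt f z =
        analyticOrderAt (fun z : ℂ => z - c) z + analyticOrderAt (dslope f c) z := fun z => by
      rw [← analyticOrderAt_mul (hlin z) (hg.analyticAt z)]
      congr 1
      ext w
      exact hfg w
    obtain ⟨q, hq, hq'⟩ := ih (dslope f c) hg (fun z => by
      have h := hord z
      rw [horder z] at h
      by_cases hz : z = c
      · subst hz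
        rw [Multiset.count_cons_self] at h
        have : analyticOrderAt (fun w : ℂ => w - z) z = 1 := analyticOrderAt_id_sub_const_self
        rw [this, Nat.cast_add, add_comm] at h
        exact (ENat.add_le_add_iff_left (by simp)).1 h
      · rw [Multiset.count_cons_of_ne hz] at h
        have : analyticOrderAt (fun w : ℂ => w - c) z = 0 := by
          rw [(hlin z).analyticOrderAt_eq_zero]
          exact sub_ne_zero.2 hz
        rwa [this, zero_add] at h)
    exact ⟨q, hq, fun z => by rw [hfg, hq', Multiset.map_cons, Multiset.prod_cons, mul_assoc]⟩

/-- **Schwarz lemma** for an entire function with zeros of order at least `m` at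
`0, 1, …, H - 1`. -/
theorem norm_iteratedDeriv_le_of_zeros {g : ℂ → ℂ} (hg : Differentiable ℂ g) {H m t : ℕ}
    (hz : ∀ h < H, ∀ k < m, iteratedDeriv k g h = 0) (ht : t < H) {R B : ℝ} (hR : 2 * H ≤ R)
    (hB : ∀ z : ℂ, ‖z‖ ≤ R → ‖g z‖ ≤ B) :
    ‖iteratedDeriv m g t‖ ≤ m.factorial * ((4 * H) ^ (m * H) * B / R ^ (m * H)) := by
  have hH1 : (1 : ℝ) ≤ H := by exact_mod_cast (by omega : 1 ≤ H)
  have ht1 : (t : ℝ) + 1 ≤ H := by exact_mod_cast ht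
  have hR0 : 0 < R := by linarith
  set S : Multiset ℂ := m • (Multiset.range H).map (fun h : ℕ => (h : ℂ)) with hS
  obtain ⟨q, hq, hgq⟩ := exists_entire_eq_prod_mul S g hg (fun c => by
    rw [hS, Multiset.count_nsmul]
    by_cases hc : c ∈ (Multiset.range H).map (fun h : ℕ => (h : ℂ))
    · rw [Multiset.count_eq_one_of_mem
        ((Multiset.nodup_range H).map Nat.cast_injective) hc, mul_one,
        natCast_le_analyticOrderAt_iff_iteratedDeriv_eq_zero (hg.analyticAt c)]
      obtain ⟨h, hh, rfl⟩ := Multiset.mem_map.1 hc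
      exact hz h (Multiset.mem_range.1 hh)
    · rw [Multiset.count_eq_zero_of_notMem hc]
      simp)
  have hprod : ∀ z : ℂ, (S.map (fun c => z - c)).prod = ∏ h ∈ Finset.range H, (z - h) ^ m := by
    intro z
    rw [hS, Multiset.map_nsmul, Multiset.prod_nsmul, Multiset.map_map, Finset.prod_pow]
    rfl
  have hB0 : 0 ≤ B := (norm_nonneg _).trans (hB 0 (by simpa using hR0.le))
  have hqb : ∀ z : ℂ, ‖z‖ ≤ R → ‖q z‖ ≤ B / (R / 2) ^ (m * H) := by
    intro z hz
    refine Complex.norm_le_of_forall_mem_frontier_norm_le (U := Metric.ball 0 R)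
      Metric.isBounded_ball hq.diffContOnCl ?_ ?_
    · intro w hw
      rw [frontier_ball _ hR0.ne', mem_sphere_zero_iff_norm] at hw
      rw [le_div_iff₀ (by positivity)]
      have h1 := hB w hw.le
      rw [hgq w, hprod, norm_mul, mul_comm] at h1
      refine le_trans ?_ h1
      gcongr
      rw [norm_prod, mul_comm m H, pow_mul]
      calc ((R / 2) ^ H) ^ m = ∏ h ∈ Finset.range H, (R / 2) ^ m := by
            rw [Finset.prod_const, Finset.card_range, ← pow_mul, ← pow_mul, mul_comm]
        _ ≤ _ := by
            refine Finset.prod_le_prod (fun _ _ => by positivity) (fun h hh => ?_)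
            rw [norm_pow]
            gcongr
            have : (h : ℝ) ≤ H := by exact_mod_cast (Finset.mem_range.1 hh).le
            have h2 := norm_sub_norm_le w (h : ℂ)
            rw [hw, Complex.norm_natCast] at h2
            linarith
    · rw [closure_ball _ hR0.ne']
      simpa using hz
  have hsphere : ∀ z ∈ Metric.sphere (t : ℂ) 1,
      ‖g z‖ ≤ (4 * H) ^ (m * H) * B / R ^ (m * H) := by
    intro z hz
    rw [mem_sphere_iff_norm] at hz
    have hzt : ‖z‖ ≤ t + 1 := by
      have := norm_sub_norm_le z (t : ℂ)
      rw [hz, Complex.norm_natCast] at this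
      linarith
    have h1 := hqb z (by linarith)
    rw [hgq z, hprod, norm_mul, norm_prod]
    calc _ ≤ (2 * H : ℝ) ^ (m * H) * (B / (R / 2) ^ (m * H)) := by
          gcongr
          rw [mul_comm m H, pow_mul]
          calc _ ≤ ∏ h ∈ Finset.range H, (2 * H : ℝ) ^ m := by
                refine Finset.prod_le_prod (fun _ _ => by positivity) (fun h hh => ?_)
                rw [norm_pow]
                gcongr
                have : (h : ℝ) ≤ H := by exact_mod_cast (Finset.mem_range.1 hh).le
                have h2 := norm_sub_le z (h : ℂ)
                rw [Complex.norm_natCast] at h2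
                linarith
            _ = _ := by
              rw [Finset.prod_const, Finset.card_range, ← pow_mul, ← pow_mul, mul_comm m H]
      _ = _ := by
          rw [div_pow, show (4 * H : ℝ) = 2 * (2 * H) by ring, mul_pow 2 (2 * H : ℝ)]
          field_simp
  have := Complex.norm_iteratedDeriv_le_of_forall_mem_sphere_norm_le m one_pos
    hg.diffContOnCl hsphere
  simpa [mul_div_assoc] using this

open Polynomial in
/-- The action of a polynomial `Q` on a polynomial `f` through `X ↦ d/dX`. -/
noncomputable def diffAct {R : Type*} [CommRing R] (Q f : R[X]) : R[X] :=
  aeval (derivative : Module.End R R[X]) Q f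

namespace diffAct

open Polynomial

variable {R S : Type*} [CommRing R] [CommRing S]

theorem mul_left (Q Q' f : R[X]) : diffAct (Q * Q') f = diffAct Q (diffAct Q' f) := by
  simp [diffAct]

theorem add_left (Q Q' f : R[X]) : diffAct (Q + Q') f = diffAct Q f + diffAct Q' f := by
  simp [diffAct]

theorem smul_left (c : R) (Q f : R[X]) : diffAct (c • Q) f = c • diffAct Q f := by
  simp [diffAct]

theorem C_left (c : R) (f : R[X]) : diffAct (C c) f = C c * f := by
  simp [diffAct, C_mul', Module.algebraMap_end_apply]

theorem X_left (f : R[X]) : diffAct X f = derivative f := by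
  simp [diffAct]

theorem one_left (f : R[X]) : diffAct 1 f = f := by
  simp [diffAct]

theorem sum_right {ι : Type*} (s : Finset ι) (Q : R[X]) (f : ι → R[X]) :
    diffAct Q (∑ i ∈ s, f i) = ∑ i ∈ s, diffAct Q (f i) := by
  simp [diffAct]

theorem C_mul_right (c : R) (Q f : R[X]) : diffAct Q (C c * f) = C c * diffAct Q f := by
  simp [diffAct, C_mul']

theorem zero_right (Q : R[X]) : diffAct Q 0 = 0 := by
  simp [diffAct]

theorem linear_left (c v : R) (f : R[X]) :
    diffAct (C c + C v * X) f = C c * f + C v * derivative f := by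
  rw [add_left, C_left, mul_left, X_left, C_left]

theorem map (φ : R →+* S) (Q f : R[X]) :
    (diffAct Q f).map φ = diffAct (Q.map φ) (f.map φ) := by
  induction Q using Polynomial.induction_on' generalizing f with
  | add p q hp hq => simp [add_left, hp, hq]
  | monomial n a =>
    rw [← C_mul_X_pow_eq_monomial]
    induction n generalizing f with
    | zero => simp [C_left]
    | succ n ih =>
      rw [pow_succ, ← mul_assoc, mul_left _ X f, ih, X_left, Polynomial.map_mul (p := C a * X ^ n),
        map_X, mul_left _ X, X_left, derivative_map]

/-- The weighted sum of the absolute values of the coefficients of `f` up to degree `k`. -/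
noncomputable def coeffSum (k : ℕ) (ρ : ℝ) (f : ℂ[X]) : ℝ :=
  ∑ i ∈ Finset.range (k + 1), ‖f.coeff i‖ * ρ ^ i

theorem coeffSum_derivative_le {k : ℕ} {ρ : ℝ} (hρ : 1 ≤ ρ) {f : ℂ[X]} (hf : f.natDegree ≤ k) :
    coeffSum k ρ (derivative f) ≤ k * coeffSum k ρ f := by
  have h0 : (derivative f).coeff k = 0 := by
    rw [coeff_derivative, coeff_eq_zero_of_natDegree_lt (by omega), zero_mul]
  rw [coeffSum, coeffSum, Finset.sum_range_succ, h0, Finset.sum_range_succ',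
    norm_zero, zero_mul, add_zero, mul_add, Finset.mul_sum]
  refine le_add_of_le_of_nonneg (Finset.sum_le_sum fun i hi => ?_) (by positivity)
  rw [coeff_derivative, norm_mul]
  have h1 : ‖(i : ℂ) + 1‖ ≤ k := by
    rw [show (i : ℂ) + 1 = ((i + 1 : ℕ) : ℂ) by push_cast; rfl, Complex.norm_natCast]
    exact_mod_cast Finset.mem_range.1 hi
  calc ‖f.coeff (i + 1)‖ * ‖(i : ℂ) + 1‖ * ρ ^ i ≤ ‖f.coeff (i + 1)‖ * k * ρ ^ (i + 1) := by
        gcongr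
        omega
    _ = _ := by ring

theorem coeffSum_linear_le {k : ℕ} {ρ : ℝ} (hρ : 1 ≤ ρ) {f : ℂ[X]} (hf : f.natDegree ≤ k)
    (c v : ℂ) : coeffSum k ρ (diffAct (C c + C v * X) f) ≤ (‖c‖ + k * ‖v‖) * coeffSum k ρ f := by
  calc coeffSum k ρ (diffAct (C c + C v * X) f)
      ≤ ‖c‖ * coeffSum k ρ f + ‖v‖ * coeffSum k ρ (derivative f) := by
        rw [linear_left, coeffSum, coeffSum, coeffSum, Finset.mul_sum, Finset.mul_sum,
          ← Finset.sum_add_distrib]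
        refine Finset.sum_le_sum fun i _ => ?_
        rw [coeff_add, coeff_C_mul, coeff_C_mul, ← mul_assoc, ← mul_assoc, ← add_mul, ← norm_mul,
          ← norm_mul]
        gcongr
        exact norm_add_le _ _
    _ ≤ ‖c‖ * coeffSum k ρ f + ‖v‖ * (k * coeffSum k ρ f) := by
        gcongr
        exact coeffSum_derivative_le hρ hf
    _ = _ := by ring

theorem natDegree_linear_le {k : ℕ} {f : ℂ[X]} (hf : f.natDegree ≤ k) (c v : ℂ) :
    (diffAct (C c + C v * X) f).natDegree ≤ k := by
  rw [linear_left]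
  refine (natDegree_add_le _ _).trans (max_le ((natDegree_C_mul_le _ _).trans hf)
    ((natDegree_C_mul_le _ _).trans ((natDegree_derivative_le f).trans (by omega))))

theorem coeffSum_prod_le {ι : Type*} (s : Finset ι) (c v : ι → ℂ) {k : ℕ} {ρ D : ℝ} (hρ : 1 ≤ ρ)
    (hD : ∀ i ∈ s, ‖c i‖ + k * ‖v i‖ ≤ D) {f : ℂ[X]} (hf : f.natDegree ≤ k) :
    coeffSum k ρ (diffAct (∏ i ∈ s, (C (c i) + C (v i) * X)) f) ≤
        D ^ s.card * coeffSum k ρ f ∧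
      (diffAct (∏ i ∈ s, (C (c i) + C (v i) * X)) f).natDegree ≤ k := by
  classical
  induction s using Finset.induction_on with
  | empty => simp [one_left, hf]
  | insert i s hi ih =>
    obtain ⟨h1, h2⟩ := ih fun j hj => hD j (Finset.mem_insert_of_mem hj)
    have hDi := hD i (Finset.mem_insert_self i s)
    have hD0 : 0 ≤ D := le_trans (by positivity) hDi
    rw [Finset.prod_insert hi, mul_left, Finset.card_insert_of_notMem hi]
    refine ⟨(coeffSum_linear_le hρ h2 _ _).trans ?_, natDegree_linear_le h2 _ _⟩
    rw [pow_succ', mul_assoc]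
    have : 0 ≤ coeffSum k ρ (diffAct (∏ i ∈ s, (C (c i) + C (v i) * X)) f) :=
      Finset.sum_nonneg fun _ _ => by positivity
    gcongr

/-- Size of the value at `x` of a product of first-order operators applied to `X ^ k`. -/
theorem norm_eval_prod_le {ι : Type*} (s : Finset ι) (c v : ι → ℂ) {k : ℕ} {ρ D : ℝ} (hρ : 1 ≤ ρ)
    (hD : ∀ i ∈ s, ‖c i‖ + k * ‖v i‖ ≤ D) {x : ℂ} (hx : ‖x‖ ≤ ρ) :
    ‖(diffAct (∏ i ∈ s, (C (c i) + C (v i) * X)) (X ^ k)).eval x‖ ≤ D ^ s.card * ρ ^ k := by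
  obtain ⟨h1, h2⟩ := coeffSum_prod_le s c v hρ hD (natDegree_X_pow_le (R := ℂ) k)
  have h3 : coeffSum k ρ (X ^ k : ℂ[X]) = ρ ^ k := by
    rw [coeffSum, Finset.sum_eq_single k]
    · simp
    · intro b _ hb
      simp [coeff_X_pow, hb]
    · simp
  rw [h3] at h1
  refine le_trans ?_ h1
  rw [eval_eq_sum_range' (Nat.lt_succ_of_le h2), coeffSum]
  refine (norm_sum_le _ _).trans (Finset.sum_le_sum fun i _ => ?_)
  rw [norm_mul, norm_pow]
  gcongr

theorem hasDerivAt_eval_mul_exp (Q f : ℂ[X]) (x v e u z : ℂ) :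
    HasDerivAt (fun z => (diffAct Q f).eval (x + z * v) * Complex.exp (e + z * u))
      ((diffAct (Q * (C u + C v * X)) f).eval (x + z * v) * Complex.exp (e + z * u)) z := by
  have h1 : HasDerivAt (fun z : ℂ => x + z * v) v z := by
    simpa using ((hasDerivAt_id z).mul_const v).const_add x
  have h2 : HasDerivAt (fun z : ℂ => e + z * u) u z := by
    simpa using ((hasDerivAt_id z).mul_const u).const_add e
  have h3 := (((diffAct Q f).hasDerivAt (x + z * v)).comp z h1).mul h2.cexp
  refine h3.congr_deriv ?_
  rw [mul_comm Q, mul_left, linear_left]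
  simp only [eval_add, eval_mul, eval_C, Function.comp_apply]
  ring

/-- Exponential polynomials with distinct frequencies are linearly independent, in terms of the
derivatives at the origin. -/
theorem eq_zero_of_forall_sum_eval_zero {ι : Type*} [Fintype ι] (b : ι → ℂ)
    (hb : Function.Injective b) (f : ι → ℂ[X])
    (h : ∀ n : ℕ, ∑ s, (diffAct ((C (b s) + X) ^ n) (f s)).eval 0 = 0) (s : ι) : f s = 0 := by
  classical
  have hQ : ∀ Q : ℂ[X], ∑ s, (diffAct (Q.comp (C (b s) + X)) (f s)).eval 0 = 0 := by
    intro Q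
    induction Q using Polynomial.induction_on' with
    | add p q hp hq => simp [add_left, Finset.sum_add_distrib, hp, hq]
    | monomial n a =>
      simp only [monomial_comp, mul_left, C_left, eval_mul, eval_C, ← Finset.mul_sum, h, mul_zero]
  by_contra hs
  set m := Finset.univ.sup (fun s => (f s).natDegree) + 1 with hm
  set j := (f s).natDegree with hj
  have hkill : ∀ g : ℂ[X], ∀ n, g.natDegree < n → diffAct (X ^ n) g = 0 := by
    intro g n hn
    have : diffAct (X ^ n) g = derivative^[n] g := by
      simp [diffAct, Module.End.pow_apply]
    rw [this, iterate_derivative_eq_zero hn]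
  have hdeg : ∀ s', (f s').natDegree < m := fun s' =>
    Nat.lt_succ_of_le (Finset.le_sup (f := fun s => (f s).natDegree) (Finset.mem_univ s'))
  have key := hQ ((∏ s' ∈ Finset.univ.erase s, (X - C (b s')) ^ m) * (X - C (b s)) ^ j)
  rw [Finset.sum_eq_single s] at key
  · have hconst : diffAct (X ^ j) (f s) = C ((j.factorial : ℂ) * (f s).leadingCoeff) := by
      have : diffAct (X ^ j) (f s) = derivative^[j] (f s) := by
        simp [diffAct, Module.End.pow_apply]
      rw [this]
      have hd : (derivative^[j] (f s)).natDegree = 0 := by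
        have := natDegree_iterate_derivative (f s) j
        omega
      rw [eq_C_of_natDegree_eq_zero hd, coeff_iterate_derivative, zero_add,
        Nat.descFactorial_self, nsmul_eq_mul, leadingCoeff]
    have hC : ∀ (t : Finset ι) (c : ℂ), diffAct (∏ s' ∈ t, (C (b s - b s') + X) ^ m) (C c) =
        C ((∏ s' ∈ t, (b s - b s') ^ m) * c) := by
      have h1 : ∀ u c : ℂ, ∀ n : ℕ, diffAct ((C u + X) ^ n) (C c) = C (u ^ n * c) := by
        intro u c n
        induction n generalizing c with
        | zero => simp [one_left]
        | succ n ih =>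
          rw [pow_succ, mul_left, add_left, X_left, derivative_C, C_left, add_zero, ← C_mul, ih,
            pow_succ, mul_assoc]
      intro t
      induction t using Finset.induction_on with
      | empty => simp [one_left]
      | insert i t hi ih =>
        intro c
        rw [Finset.prod_insert hi, mul_left, ih, h1, Finset.prod_insert hi, mul_assoc]
    have hcomp : ((∏ s' ∈ Finset.univ.erase s, (X - C (b s')) ^ m) * (X - C (b s)) ^ j).comp
        (C (b s) + X) = (∏ s' ∈ Finset.univ.erase s, (C (b s - b s') + X) ^ m) * X ^ j := by
      have hx : ∀ c : ℂ, (X - C c).comp (C (b s) + X) = C (b s - c) + X := fun c => by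
        rw [sub_comp, X_comp, C_comp, C_sub]
        ring
      simp only [mul_comp, prod_comp, pow_comp, hx, sub_self, C_0, zero_add]
    rw [hcomp, mul_left, hconst, hC, eval_C] at key
    refine mul_ne_zero (Finset.prod_ne_zero_iff.2 fun s' hs' => pow_ne_zero _ (sub_ne_zero.2
      fun h => (Finset.ne_of_mem_erase hs') (hb h.symm))) (mul_ne_zero ?_ ?_) key
    · exact_mod_cast j.factorial_ne_zero
    · exact leadingCoeff_ne_zero.2 hs
  · intro s' _ hs'
    rw [mul_comp, prod_comp, ← Finset.mul_prod_erase _ _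
      (Finset.mem_erase.2 ⟨hs', Finset.mem_univ s'⟩), pow_comp, sub_comp, X_comp, C_comp,
      add_sub_cancel_left, mul_assoc, mul_comm (X ^ m), mul_left, hkill _ _ (hdeg s'), zero_right,
      eval_zero]
  · simp

end diffAct

/-- `X N T R` is at most `A ^ T * R ^ (e * T)` for some constant `A`, in the range
`1 ≤ N ≤ R`, `R ^ (d + 1) ≤ T ≤ (2 * R) ^ (d + 1)`. -/
def PowBounded (d e : ℕ) (X : ℕ → ℕ → ℕ → ℝ) : Prop :=
  ∃ A : ℝ, 1 ≤ A ∧ ∀ N T R : ℕ, 1 ≤ N → N ≤ R → R ^ (d + 1) ≤ T → T ≤ (2 * R) ^ (d + 1) →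
    0 ≤ X N T R ∧ X N T R ≤ A ^ T * (R : ℝ) ^ (e * T)

namespace PowBounded

variable {d e e' : ℕ} {X Y : ℕ → ℕ → ℕ → ℝ}

theorem mul (hX : PowBounded d e X) (hY : PowBounded d e' Y) :
    PowBounded d (e + e') (fun N T R => X N T R * Y N T R) := by
  obtain ⟨A, hA, h⟩ := hX
  obtain ⟨A', hA', h'⟩ := hY
  refine ⟨A * A', one_le_mul_of_one_le_of_one_le hA hA', fun N T R h1 h2 h3 h4 => ?_⟩
  obtain ⟨a1, a2⟩ := h N T R h1 h2 h3 h4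
  obtain ⟨b1, b2⟩ := h' N T R h1 h2 h3 h4
  refine ⟨mul_nonneg a1 b1, (mul_le_mul a2 b2 b1 (by positivity)).trans (le_of_eq ?_)⟩
  rw [mul_pow, add_mul, pow_add]
  ring

theorem pow (hX : PowBounded d e X) (n : ℕ) :
    PowBounded d (n * e) (fun N T R => X N T R ^ n) := by
  obtain ⟨A, hA, h⟩ := hX
  refine ⟨A ^ n, one_le_pow₀ hA, fun N T R h1 h2 h3 h4 => ?_⟩
  obtain ⟨a1, a2⟩ := h N T R h1 h2 h3 h4
  refine ⟨pow_nonneg a1 n, (pow_le_pow_left₀ a1 a2 n).trans (le_of_eq ?_)⟩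
  rw [mul_pow, ← pow_mul, ← pow_mul, ← pow_mul]
  congr 2 <;> ring

theorem mono (hX : PowBounded d e X) (hY0 : ∀ N T R, 0 ≤ Y N T R)
    (h : ∀ N T R : ℕ, 1 ≤ N → N ≤ R → R ^ (d + 1) ≤ T → Y N T R ≤ X N T R) :
    PowBounded d e Y := by
  obtain ⟨A, hA, h'⟩ := hX
  exact ⟨A, hA, fun N T R h1 h2 h3 h4 =>
    ⟨hY0 N T R, (h N T R h1 h2 h3).trans (h' N T R h1 h2 h3 h4).2⟩⟩

theorem const_pow {c : ℝ} (hc : 1 ≤ c) (n : ℕ) : PowBounded d 0 (fun _ T _ => c ^ (n * T)) :=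
  ⟨c ^ n, one_le_pow₀ hc, fun N T R _ _ _ _ => ⟨by positivity, by simp [pow_mul]⟩⟩

theorem const {c : ℝ} (hc : 1 ≤ c) : PowBounded d 0 (fun _ _ _ => c) :=
  (const_pow hc 1).mono (fun _ _ _ => by linarith) fun N T R h1 h2 h3 => by
    have : 1 ≤ T := (Nat.one_le_pow _ _ (h1.trans h2)).trans h3
    exact le_self_pow₀ hc (by omega)

theorem exp_mul (n : ℕ) : PowBounded d 0 (fun _ T _ => Real.exp (n * T)) :=
  (const_pow (Real.one_le_exp zero_le_one) n).mono (fun _ _ _ => by positivity)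
    fun N T R _ _ _ => by
      rw [← Real.exp_nat_mul]
      push_cast
      simp

/-- `T ^ T` has exponent `d + 1`. -/
theorem self_pow : PowBounded d (d + 1) (fun _ T _ => (T : ℝ) ^ T) := by
  refine ⟨2 ^ (d + 1), one_le_pow₀ one_le_two, fun N T R h1 h2 h3 h4 => ⟨by positivity, ?_⟩⟩
  have : (T : ℝ) ≤ (2 * R) ^ (d + 1) := by exact_mod_cast h4
  calc (T : ℝ) ^ T ≤ ((2 * R) ^ (d + 1)) ^ T := by gcongr
    _ = _ := by rw [mul_pow, mul_pow, pow_mul (R : ℝ)]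

end PowBounded

/-- The degree parameter `2 * H * N ^ d` of the auxiliary function. -/
def auxDegree (d H N : ℕ) : ℕ := 2 * H * N ^ d

/-- Bound for the conjugates of the coefficients of order `t` of the linear system. -/
noncomputable def entryBound (d C r H L t : ℕ) : ℝ :=
  (2 * d * L * C) ^ t * ((d * H * C) ^ L * C ^ (d ^ 2 * H * L * C * r))

/-- Bound for the coefficients of the auxiliary function. -/
noncomputable def coeffBound (d C r H N : ℕ) : ℝ :=
  C ^ 2 * (auxDegree d H N ^ (d + 1) * entryBound d C r H (auxDegree d H N) (d * N ^ (d + 1)))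

/-- Bound for the auxiliary function and its derivatives of order at most `T` in a disc of
radius `R`. -/
noncomputable def growthBound (d C r H N T R : ℕ) : ℝ :=
  auxDegree d H N ^ (d + 1) * (coeffBound d C r H N *
    ((2 * d * auxDegree d H N * C) ^ T * ((d * H * C + R * C) ^ auxDegree d H N *
      Real.exp (d ^ 2 * H * auxDegree d H N * C + R * (d * auxDegree d H N * C)))))

section

variable {d C r H : ℕ}

theorem auxDegree_mul_le {N T R : ℕ} (h1 : N ≤ R) (h2 : R ^ (d + 1) ≤ T) :
    auxDegree d H N * R ≤ 2 * H * T := by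
  calc auxDegree d H N * R = 2 * H * (N ^ d * R) := by rw [auxDegree, mul_assoc]
    _ ≤ 2 * H * (R ^ d * R) := by gcongr
    _ ≤ 2 * H * T := by rw [← pow_succ]; gcongr

theorem auxDegree_le {N T R : ℕ} (h0 : 1 ≤ N) (h1 : N ≤ R) (h2 : R ^ (d + 1) ≤ T) :
    auxDegree d H N ≤ 2 * H * T :=
  (Nat.le_mul_of_pos_right _ (by omega)).trans (auxDegree_mul_le h1 h2)

theorem PowBounded.const_pow_auxDegree {c : ℝ} (hc : 1 ≤ c) (n : ℕ) :
    PowBounded d 0 (fun N _ _ => c ^ (n * auxDegree d H N)) :=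
  (PowBounded.const_pow hc (n * (2 * H))).mono (fun _ _ _ => by positivity)
    fun N T R h1 h2 h3 => by
      refine pow_le_pow_right₀ hc ?_
      rw [mul_assoc n]
      exact Nat.mul_le_mul_left n (auxDegree_le h1 h2 h3)

theorem PowBounded.auxDegree_pow :
    PowBounded d 0 (fun N _ _ => (auxDegree d H N : ℝ) ^ (d + 1)) :=
  (PowBounded.const_pow_auxDegree (H := H) (Real.one_le_exp zero_le_one) (d + 1)).mono
    (fun _ _ _ => by positivity) fun N T R _ _ _ => by
      rw [mul_comm, pow_mul]
      gcongr
      rw [← Real.exp_nat_mul, mul_one]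
      linarith [Real.add_one_le_exp (auxDegree d H N : ℝ)]

theorem PowBounded.mul_auxDegree_pow (hd : 1 ≤ d) (hC : 1 ≤ C) (hH : 1 ≤ H) :
    PowBounded d d (fun N T _ => (2 * d * auxDegree d H N * C : ℝ) ^ T) := by
  have hd' : (1 : ℝ) ≤ d := by exact_mod_cast hd
  have hC' : (1 : ℝ) ≤ C := by exact_mod_cast hC
  have hH' : (1 : ℝ) ≤ H := by exact_mod_cast hH
  have hA : (1 : ℝ) ≤ 2 * d * (2 * H) * C := by
    have : (1 : ℝ) ≤ d * H * C := one_le_mul_of_one_le_of_one_le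
      (one_le_mul_of_one_le_of_one_le hd' hH') hC'
    nlinarith
  refine ⟨2 * d * (2 * H) * C, hA, fun N T R h1 h2 h3 h4 => ⟨by positivity, ?_⟩⟩
  have : (N : ℝ) ^ d ≤ R ^ d := by gcongr
  rw [pow_mul, ← mul_pow]
  refine pow_le_pow_left₀ (by positivity) ?_ T
  rw [auxDegree]
  push_cast
  calc (2 * d * (2 * H * N ^ d) * C : ℝ) = 2 * d * (2 * H) * C * N ^ d := by ring
    _ ≤ _ := by gcongr

theorem PowBounded.entry (hd : 1 ≤ d) (hC : 1 ≤ C) (hH : 1 ≤ H) :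
    PowBounded d d (fun N T _ => entryBound d C r H (auxDegree d H N) T) := by
  have hd' : (1 : ℝ) ≤ d := by exact_mod_cast hd
  have hC' : (1 : ℝ) ≤ C := by exact_mod_cast hC
  have hH' : (1 : ℝ) ≤ H := by exact_mod_cast hH
  have h2 : (1 : ℝ) ≤ d * H * C := one_le_mul_of_one_le_of_one_le
      (one_le_mul_of_one_le_of_one_le hd' hH') hC'
  refine ((PowBounded.mul_auxDegree_pow hd hC hH).mul
    ((PowBounded.const_pow_auxDegree (H := H) h2 1).mul
      (PowBounded.const_pow_auxDegree (H := H) hC' (d ^ 2 * H * C * r)))).mono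
      (fun _ _ _ => by rw [entryBound]; positivity) fun N T R _ _ _ => le_of_eq ?_
  rw [entryBound, one_mul]
  congr 3
  ring

theorem PowBounded.coeff (hd : 1 ≤ d) (hC : 1 ≤ C) (hH : 1 ≤ H) :
    PowBounded d (d * d) (fun N _ _ => coeffBound d C r H N) := by
  have hd' : (1 : ℝ) ≤ d := by exact_mod_cast hd
  have hC' : (1 : ℝ) ≤ C := by exact_mod_cast hC
  have hH' : (1 : ℝ) ≤ H := by exact_mod_cast hH
  have h2 : (1 : ℝ) ≤ d * H * C := one_le_mul_of_one_le_of_one_le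
      (one_le_mul_of_one_le_of_one_le hd' hH') hC'
  have := (PowBounded.const (d := d) (one_le_pow₀ hC' (n := 2))).mul
    ((PowBounded.auxDegree_pow (d := d) (H := H)).mul
    (((PowBounded.mul_auxDegree_pow hd hC hH).pow d).mul
    ((PowBounded.const_pow_auxDegree (H := H) h2 1).mul
      (PowBounded.const_pow_auxDegree (H := H) hC' (d ^ 2 * H * C * r)))))
  simp only [zero_add, add_zero] at this
  refine this.mono (fun _ _ _ => by rw [coeffBound, entryBound]; positivity)
    fun N T R h1 h3 h4 => ?_
  have hL : (1 : ℝ) ≤ auxDegree d H N := by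
    rw [auxDegree]
    exact_mod_cast Nat.mul_pos (by omega) (pow_pos (by omega) _)
  rw [coeffBound, entryBound, one_mul, ← pow_mul]
  gcongr ?_ * (?_ * (?_ * (?_ * ?_)))
  · refine pow_le_pow_right₀ ?_ ?_
    · have : (1 : ℝ) ≤ d * auxDegree d H N * C := one_le_mul_of_one_le_of_one_le
        (one_le_mul_of_one_le_of_one_le hd' hL) hC'
      linarith
    · rw [mul_comm]
      exact Nat.mul_le_mul_right d ((Nat.pow_le_pow_left h3 _).trans h4)
  · refine le_of_eq ?_
    congr 1
    ring

theorem PowBounded.growth (hd : 1 ≤ d) (hC : 1 ≤ C) (hH : 1 ≤ H) :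
    PowBounded d (d * d + d) (fun N T R => growthBound d C r H N T R) := by
  have hd' : (1 : ℝ) ≤ d := by exact_mod_cast hd
  have hC' : (1 : ℝ) ≤ C := by exact_mod_cast hC
  have hH' : (1 : ℝ) ≤ H := by exact_mod_cast hH
  have h2 : (1 : ℝ) ≤ 2 * d * H * C := by
    have : (1 : ℝ) ≤ d * H * C := one_le_mul_of_one_le_of_one_le
      (one_le_mul_of_one_le_of_one_le hd' hH') hC'
    linarith
  have := (PowBounded.auxDegree_pow (d := d) (H := H)).mul ((PowBounded.coeff (r := r) hd hC hH).mul
    ((PowBounded.mul_auxDegree_pow hd hC hH).mul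
    ((((PowBounded.const_pow_auxDegree (d := d) (H := H) h2 1).mul (PowBounded.exp_mul (2 * H))).mul
      (PowBounded.exp_mul (d ^ 2 * H * C * (2 * H) + d * C * (2 * H))))))) 
  simp only [zero_add, add_zero] at this
  refine this.mono
    (fun _ _ _ => by rw [growthBound, coeffBound, entryBound]; positivity) fun N T R h1 h3 h4 => ?_
  have hR : (1 : ℝ) ≤ R := by exact_mod_cast h1.trans h3
  have hL1 : (auxDegree d H N : ℝ) ≤ 2 * H * T := by exact_mod_cast auxDegree_le h1 h3 h4
  have hL2 : (auxDegree d H N : ℝ) * R ≤ 2 * H * T := by exact_mod_cast auxDegree_mul_le h3 h4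
  have hcb : 0 ≤ coeffBound d C r H N := by rw [coeffBound, entryBound]; positivity
  rw [growthBound]
  gcongr ?_ * (?_ * (?_ * (?_ * ?_)))
  · rw [one_mul]
    calc (d * H * C + R * C : ℝ) ^ auxDegree d H N
        ≤ (2 * d * H * C * R) ^ auxDegree d H N := by
          gcongr
          have e1 : (d * H * C * 1 : ℝ) ≤ d * H * C * R := by gcongr
          have e2 : (1 * 1 * (R * C) : ℝ) ≤ d * H * (R * C) := by gcongr
          linarith
      _ = (2 * d * H * C) ^ auxDegree d H N * (R : ℝ) ^ auxDegree d H N := mul_pow _ _ _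
      _ ≤ _ := by
          gcongr
          calc (R : ℝ) ^ auxDegree d H N ≤ Real.exp R ^ auxDegree d H N := by
                gcongr
                linarith [Real.add_one_le_exp (R : ℝ)]
            _ = Real.exp (auxDegree d H N * R) := by rw [Real.exp_nat_mul]
            _ ≤ _ := by
                push_cast
                gcongr
  · refine Real.exp_le_exp.2 ?_
    push_cast
    calc (d ^ 2 * H * auxDegree d H N * C + R * (d * auxDegree d H N * C) : ℝ)
        = d ^ 2 * H * C * auxDegree d H N + d * C * (auxDegree d H N * R) := by ring
      _ ≤ d ^ 2 * H * C * (2 * H * T) + d * C * (2 * H * T) := by gcongr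
      _ = _ := by ring

/-- For suitable parameters, the analytic upper bound contradicts the arithmetic lower bound. -/
theorem exists_parameters (hd : 1 ≤ d) (hC : 1 ≤ C) (r : ℕ) :
    ∃ H N : ℕ, 1 ≤ H ∧ 1 ≤ N ∧ 2 * H ≤ N ∧ ∀ T R m : ℕ, N ≤ R → R ^ (d + 1) ≤ T →
      T ≤ (2 * R) ^ (d + 1) → T ≤ d * m → m ≤ T →
      (auxDegree d H N ^ (d + 1) * (coeffBound d C r H N *
          entryBound d C r H (auxDegree d H N) T)) ^ d *
        (C ^ T * C ^ (d ^ 2 * H * auxDegree d H N * C * r) * (d * C) ^ T *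
        (m.factorial * ((4 * H) ^ (m * H) * growthBound d C r H N T R / R ^ (m * H)))) < 1 := by
  set E := d * (d * d + d) + (d + 1 + (d * d + d)) with hE
  set H := d * (E + 1) with hH
  have hH1 : 1 ≤ H := Nat.mul_pos (by omega) (by omega)
  have hd' : (1 : ℝ) ≤ d := by exact_mod_cast hd
  have hC' : (1 : ℝ) ≤ C := by exact_mod_cast hC
  have hH' : (1 : ℝ) ≤ H := by exact_mod_cast hH1
  have hP : PowBounded d E (fun N T R => (auxDegree d H N ^ (d + 1) * (coeffBound d C r H N *
          entryBound d C r H (auxDegree d H N) T)) ^ d *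
        ((C ^ (1 * T) * C ^ ((d ^ 2 * H * C * r) * auxDegree d H N) * (d * C) ^ (1 * T)) *
        ((T : ℝ) ^ T * ((4 * H) ^ (H * T) * growthBound d C r H N T R)))) := by
    have := ((PowBounded.auxDegree_pow (d := d) (H := H)).mul
      ((PowBounded.coeff (r := r) hd hC hH1).mul (PowBounded.entry (r := r) hd hC hH1))).pow d
      |>.mul ((((PowBounded.const_pow hC' 1).mul
        (PowBounded.const_pow_auxDegree (H := H) hC' (d ^ 2 * H * C * r))).mul
        (PowBounded.const_pow (one_le_mul_of_one_le_of_one_le hd' hC') 1)).mul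
        (PowBounded.self_pow.mul ((PowBounded.const_pow (c := 4 * H) (by linarith) H).mul
          (PowBounded.growth (r := r) hd hC hH1))))
    simp only [zero_add] at this
    exact this
  obtain ⟨A, hA, hP⟩ := hP
  obtain ⟨N, hN⟩ := exists_nat_gt (A + 2 * H)
  have hNH : 2 * H ≤ N := by
    have : (2 * H : ℝ) ≤ N := by linarith
    exact_mod_cast this
  refine ⟨H, N, hH1, by omega, hNH, fun T R m hNR h1 h2 h3 h4 => ?_⟩
  have hR1 : (1 : ℝ) ≤ R := by exact_mod_cast (by omega : 1 ≤ R)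
  have hR0 : (0 : ℝ) < R := by linarith
  have hRA : A < R := by
    have : (N : ℝ) ≤ R := by exact_mod_cast hNR
    linarith
  have hT : T ≠ 0 := by
    have := Nat.one_le_pow (d + 1) R (by omega)
    omega
  have hmain := (hP N T R (by omega) hNR h1 h2).2
  have hcb : 0 ≤ coeffBound d C r H N := by rw [coeffBound, entryBound]; positivity
  have heb : 0 ≤ entryBound d C r H (auxDegree d H N) T := by rw [entryBound]; positivity
  have hgb : 0 ≤ growthBound d C r H N T R := by rw [growthBound]; positivity
  have hfac : (m.factorial : ℝ) ≤ T ^ T := by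
    have : m.factorial ≤ T ^ T := (Nat.factorial_le h4).trans (Nat.factorial_le_pow T)
    exact_mod_cast this
  have hpow : (4 * H : ℝ) ^ (m * H) ≤ (4 * H) ^ (H * T) := by
    refine pow_le_pow_right₀ (by linarith) ?_
    rw [mul_comm]
    gcongr
  have hden : (R : ℝ) ^ (E * T) * (R : ℝ) ^ T ≤ R ^ (m * H) := by
    rw [← pow_add]
    refine pow_le_pow_right₀ hR1 ?_
    calc E * T + T = T * (E + 1) := by ring
      _ ≤ d * m * (E + 1) := by gcongr
      _ = m * H := by rw [hH]; ring
  calc _ ≤ (auxDegree d H N ^ (d + 1) * (coeffBound d C r H N *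
          entryBound d C r H (auxDegree d H N) T)) ^ d *
        (C ^ T * C ^ (d ^ 2 * H * auxDegree d H N * C * r) * (d * C) ^ T *
        (T ^ T * ((4 * H) ^ (H * T) * growthBound d C r H N T R / R ^ (m * H)))) := by gcongr
    _ = (auxDegree d H N ^ (d + 1) * (coeffBound d C r H N *
          entryBound d C r H (auxDegree d H N) T)) ^ d *
        ((C ^ (1 * T) * C ^ ((d ^ 2 * H * C * r) * auxDegree d H N) * (d * C) ^ (1 * T)) *
        ((T : ℝ) ^ T * ((4 * H) ^ (H * T) * growthBound d C r H N T R))) / R ^ (m * H) := by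
        rw [one_mul, show d ^ 2 * H * auxDegree d H N * C * r =
          d ^ 2 * H * C * r * auxDegree d H N by ring]
        ring
    _ ≤ A ^ T * (R : ℝ) ^ (E * T) / ((R : ℝ) ^ (E * T) * (R : ℝ) ^ T) := by gcongr
    _ = (A / R) ^ T := by
        rw [div_pow]
        field_simp
    _ < 1 := pow_lt_one₀ (by positivity) ((div_lt_one hR0).2 hRA) hT

end

/-- The exponential polynomial `∑ i, p i * χ ^ k i * exp (ω i)` on a complex vector space, given by
linear forms `χ` and `ω i`. -/
structure ExpPoly (V I : Type*) [AddCommGroup V] [Module ℂ V] where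
  /-- the coefficients -/
  coeff : I → ℂ
  /-- the exponents of the linear form `χ` -/
  deg : I → ℕ
  /-- the linear form whose powers occur in the polynomial part -/
  χ : V →ₗ[ℂ] ℂ
  /-- the frequencies -/
  ω : I → V →ₗ[ℂ] ℂ

namespace ExpPoly

open Polynomial

variable {V I : Type*} [AddCommGroup V] [Module ℂ V] (F : ExpPoly V I)

/-- The symbol of the derivation in the direction `u`. -/
noncomputable def symbol : V →ₗ[ℂ] (I → ℂ[X]) where
  toFun u i := C (F.ω i u) + C (F.χ u) * X
  map_add' u v := by
    ext1 i
    simp only [map_add, Pi.add_apply]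
    ring
  map_smul' c u := by
    ext1 i
    simp only [map_smul, Pi.smul_apply, smul_eq_mul, C_mul, RingHom.id_apply, smul_eq_C_mul]
    ring

theorem symbol_apply (u : V) (i : I) : F.symbol u i = C (F.ω i u) + C (F.χ u) * X := rfl

theorem prod_symbol_mem_pow {κ : Type*} (s : Finset κ) (u : κ → V) :
    ∏ i ∈ s, F.symbol (u i) ∈ LinearMap.range F.symbol ^ s.card := by
  classical
  induction s using Finset.induction_on with
  | empty => exact ⟨1, by simp⟩
  | insert a s ha ih =>
    rw [Finset.prod_insert ha, Finset.card_insert_of_notMem ha, pow_succ']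
    exact Submodule.mul_mem_mul ⟨_, rfl⟩ ih

variable [Fintype I]

/-- The value at `w` of the image of the exponential polynomial under the constant coefficient
differential operator with symbol `Q`. -/
noncomputable def value (w : V) : (I → ℂ[X]) →ₗ[ℂ] ℂ where
  toFun Q := ∑ i, F.coeff i *
    ((diffAct (Q i) (X ^ F.deg i)).eval (F.χ w) * Complex.exp (F.ω i w))
  map_add' Q Q' := by
    simp only [Pi.add_apply, diffAct.add_left, eval_add, ← Finset.sum_add_distrib]
    exact Finset.sum_congr rfl fun _ _ => by ring
  map_smul' c Q := by
    simp only [Pi.smul_apply, diffAct.smul_left, eval_smul, smul_eq_mul, RingHom.id_apply,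
      Finset.mul_sum]
    exact Finset.sum_congr rfl fun _ _ => by ring

theorem value_apply (w : V) (Q : I → ℂ[X]) :
    F.value w Q = ∑ i, F.coeff i *
      ((diffAct (Q i) (X ^ F.deg i)).eval (F.χ w) * Complex.exp (F.ω i w)) := rfl

theorem hasDerivAt_value (Q : I → ℂ[X]) (w v : V) (z : ℂ) :
    HasDerivAt (fun z : ℂ => F.value (w + z • v) Q) (F.value (w + z • v) (Q * F.symbol v)) z := by
  simp only [value_apply, map_add, map_smul, smul_eq_mul]
  exact HasDerivAt.fun_sum fun i _ =>
    (diffAct.hasDerivAt_eval_mul_exp (Q i) (X ^ F.deg i) (F.χ w) (F.χ v) (F.ω i w)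
      (F.ω i v) z).const_mul (F.coeff i)

theorem iteratedDeriv_value (Q : I → ℂ[X]) (w v : V) (n : ℕ) :
    iteratedDeriv n (fun z : ℂ => F.value (w + z • v) Q) =
      fun z : ℂ => F.value (w + z • v) (Q * F.symbol v ^ n) := by
  induction n with
  | zero => simp
  | succ n ih =>
    rw [iteratedDeriv_succ, ih]
    funext z
    rw [(F.hasDerivAt_value _ w v z).deriv, pow_succ, mul_assoc]

open scoped Pointwise in
/-- If all derivatives along a spanning family of order `n` vanish at `w`, so do all derivatives of
order `n`. -/
theorem value_eq_zero_of_mem_pow {G : Type*} {e : G → V} (he : Submodule.span ℂ (Set.range e) = ⊤)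
    {w : V} {n : ℕ} (h : ∀ σ : Fin n → G, F.value w (∏ i, F.symbol (e (σ i))) = 0)
    {Q : I → ℂ[X]} (hQ : Q ∈ LinearMap.range F.symbol ^ n) : F.value w Q = 0 := by
  have h1 : LinearMap.range F.symbol = Submodule.span ℂ (Set.range fun g => F.symbol (e g)) := by
    rw [LinearMap.range_eq_map, ← he, Submodule.map_span, ← Set.range_comp]
    rfl
  rw [h1, Submodule.span_pow] at hQ
  suffices hle : Submodule.span ℂ ((Set.range fun g => F.symbol (e g)) ^ n) ≤
    LinearMap.ker (F.value w) from hle hQ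
  refine Submodule.span_le.2 fun q hq => ?_
  obtain ⟨f, rfl⟩ := Set.mem_pow.1 hq
  choose σ hσ using fun i => (f i).2
  have := h σ
  simp only [hσ] at this
  rw [List.prod_ofFn]
  exact this

/-- If the family `e` is expressed through the family `y` with coefficients bounded by `C`, a
derivative along `e` is controlled by some derivative along `y`. -/
theorem exists_norm_value_le {G J : Type*} [Fintype J] [Nonempty J] {e : G → V} {y : J → V}
    {c : G → J → ℂ} (hc : ∀ g, e g = ∑ j, c g j • y j) {C : ℝ} (hC : ∀ g j, ‖c g j‖ ≤ C)
    {T : ℕ} (σ : Fin T → G) (w : V) :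
    ∃ r : Fin T → J, ‖F.value w (∏ i, F.symbol (e (σ i)))‖ ≤
      (Fintype.card J * C) ^ T * ‖F.value w (∏ i, F.symbol (y (r i)))‖ := by
  classical
  obtain ⟨r, hr⟩ := Finite.exists_max fun r : Fin T → J =>
    ‖F.value w (∏ i, F.symbol (y (r i)))‖
  refine ⟨r, ?_⟩
  have key : ∏ i, F.symbol (e (σ i)) =
      ∑ r : Fin T → J, (∏ i, c (σ i) (r i)) • ∏ i, F.symbol (y (r i)) := by
    simp_rw [hc, map_sum, map_smul, Finset.prod_univ_sum, Fintype.piFinset_univ,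
      Finset.prod_smul]
  rw [key, map_sum]
  refine (norm_sum_le _ _).trans ?_
  calc ∑ r' : Fin T → J, ‖F.value w ((∏ i, c (σ i) (r' i)) • ∏ i, F.symbol (y (r' i)))‖
      ≤ ∑ _r' : Fin T → J, C ^ T * ‖F.value w (∏ i, F.symbol (y (r i)))‖ := by
        refine Finset.sum_le_sum fun r' _ => ?_
        rw [map_smul, norm_smul, norm_prod]
        refine mul_le_mul ?_ (hr r') (norm_nonneg _) ?_
        · calc ∏ i, ‖c (σ i) (r' i)‖ ≤ ∏ _i : Fin T, C :=
              Finset.prod_le_prod (fun _ _ => norm_nonneg _) fun i _ => hC _ _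
            _ = C ^ T := by simp
        · rcases T.eq_zero_or_pos with rfl | hT
          · simp
          · exact pow_nonneg ((norm_nonneg _).trans (hC (σ ⟨0, hT⟩) (r ⟨0, hT⟩))) _
    _ = _ := by simp [mul_pow, mul_assoc]

/-- The Schwarz lemma applied to an exponential polynomial along the line with direction `y j`. -/
theorem norm_value_le_of_zeros {J : Type*} [Fintype J] [DecidableEq J] {y : J → V} {H T : ℕ}
    (hz : ∀ t : J → ℕ, (∀ j, t j < H) → ∀ n < T, ∀ Q ∈ LinearMap.range F.symbol ^ n,
      F.value (∑ j, t j • y j) Q = 0)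
    {t : J → ℕ} (ht : ∀ j, t j < H) (r : Fin T → J) (j : J) {m : ℕ}
    (hm : (Finset.univ.filter fun i => r i = j).card = m) {R B : ℝ} (hR : 2 * H ≤ R)
    (hB : ∀ t : J → ℕ, (∀ j, t j < H) → ∀ z : ℂ, ‖z‖ ≤ R →
      ‖F.value (∑ j, t j • y j + z • y j)
        (∏ i with r i ≠ j, F.symbol (y (r i)))‖ ≤ B) :
    ‖F.value (∑ j, t j • y j) (∏ i, F.symbol (y (r i)))‖ ≤
      m.factorial * ((4 * H) ^ (m * H) * B / R ^ (m * H)) := by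
  set Q := ∏ i with r i ≠ j, F.symbol (y (r i)) with hQ
  have hprod : ∏ i, F.symbol (y (r i)) = Q * F.symbol (y j) ^ m := by
    rw [hQ, ← Finset.prod_filter_not_mul_prod_filter _ (fun i => r i = j)]
    congr 1
    rw [← hm, ← Finset.prod_const]
    exact Finset.prod_congr rfl fun i hi => by rw [(Finset.mem_filter.1 hi).2]
  have hcard : (Finset.univ.filter fun i => r i ≠ j).card + m = T := by
    rw [← hm, add_comm, Finset.card_filter_add_card_filter_not]
    simp
  have hH : 0 < H := (Nat.zero_le _).trans_lt (ht j)
  have hupd (h : ℕ) (hh : h < H) (i : J) : Function.update t j h i < H := by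
    by_cases hi : i = j
    · subst hi; simpa
    · simpa [hi] using ht i
  have hw (h : ℕ) : ∑ i, Function.update t j h i • y i =
      ∑ i, Function.update t j 0 i • y i + (h : ℂ) • y j := by
    rw [← Finset.add_sum_erase _ _ (Finset.mem_univ j),
      ← Finset.add_sum_erase _ (fun i => Function.update t j 0 i • y i) (Finset.mem_univ j)]
    simp only [Function.update_self, zero_smul, zero_add]
    rw [add_comm, Nat.cast_smul_eq_nsmul]
    congr 1
    refine Finset.sum_congr rfl fun i hi => ?_
    simp [Finset.ne_of_mem_erase hi]
  set w := ∑ i, Function.update t j 0 i • y i with hw0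
  have hd : Differentiable ℂ fun z : ℂ => F.value (w + z • y j) Q :=
    fun z => (F.hasDerivAt_value Q w (y j) z).differentiableAt
  have := norm_iteratedDeriv_le_of_zeros hd (H := H) (m := m) (t := t j) (B := B) ?_ (ht j) hR ?_
  · rw [F.iteratedDeriv_value] at this
    rw [hprod]
    have e := hw (t j)
    rw [Function.update_eq_self] at e
    rw [e]
    exact this
  · intro h hh k hk
    rw [F.iteratedDeriv_value]
    have := hz _ (hupd h hh) ((Finset.univ.filter fun i => r i ≠ j).card + k) (by omega)
      (Q * F.symbol (y j) ^ k) (by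
        rw [pow_add]
        refine Submodule.mul_mem_mul (F.prod_symbol_mem_pow _ _) ?_
        exact Submodule.pow_mem_pow _ (LinearMap.mem_range_self _ _) k)
    rwa [hw h] at this
  · intro z hzR
    exact hB _ (hupd 0 hH) z hzR

/-- An exponential polynomial in one variable all of whose derivatives at the origin vanish has
zero coefficients. -/
theorem coeff_eq_zero_of_value_pow {L : ℕ} {S : Type*} [Fintype S] (F : ExpPoly V (Fin L × S))
    (hdeg : ∀ i, F.deg i = i.1) (e : V) (hχ : F.χ e = 1) (b : S → ℂ) (hb : Function.Injective b)
    (hω : ∀ i, F.ω i e = b i.2) (h : ∀ n, F.value 0 (F.symbol e ^ n) = 0) : F.coeff = 0 := by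
  classical
  have key := diffAct.eq_zero_of_forall_sum_eval_zero b hb
    (fun s => ∑ k : Fin L, C (F.coeff (k, s)) * X ^ (k : ℕ)) (fun n => ?_)
  · ext ⟨k, s⟩
    have := congrArg (fun q : ℂ[X] => q.coeff k) (key s)
    simp only [finsetSum_coeff, coeff_C_mul, coeff_X_pow, coeff_zero, Fin.val_inj] at this
    simpa using this
  · refine Eq.trans ?_ (h n)
    rw [value_apply, Fintype.sum_prod_type_right]
    refine Finset.sum_congr rfl fun s _ => ?_
    rw [diffAct.sum_right, eval_finsetSum]
    refine Finset.sum_congr rfl fun k _ => ?_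
    simp [diffAct.C_mul_right, symbol_apply, hdeg, hχ, hω]

end ExpPoly

open NumberField

theorem exists_nat_forall_le {ι : Type*} [Finite ι] (f : ι → ℝ) : ∃ C : ℕ, ∀ i, f i ≤ C := by
  obtain ⟨B, hB⟩ := (Set.finite_range f).bddAbove
  obtain ⟨C, hC⟩ := exists_nat_ge B
  exact ⟨C, fun i => (hB ⟨i, rfl⟩).trans hC⟩

theorem house_le_of_forall_embedding {K : Type*} [Field K] [NumberField K] {x : K} {B : ℝ}
    (h : ∀ ψ : K →+* ℂ, ‖ψ x‖ ≤ B) : house x ≤ B := by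
  have : Nonempty (K →+* ℂ) := inferInstance
  exact (pi_norm_le_iff_of_nonempty _).2 h

universe u v w

open scoped Classical in
/-- Siegel's lemma over the ring of integers of a number field, in the case of at least twice as
many unknowns as equations. -/
theorem exists_siegel_constant (K : Type u) [Field K] [NumberField K] :
    ∃ c : ℕ, ∀ {α : Type v} {β : Type w} [Fintype α] [Fintype β] (a : Matrix α β (𝓞 K)),
      0 < Fintype.card α → 2 * Fintype.card α ≤ Fintype.card β → ∀ {A : ℝ}, 1 ≤ A →
      (∀ k l, house (a k l : K) ≤ A) → ∃ ξ : β → 𝓞 K, ξ ≠ 0 ∧ a.mulVec ξ = 0 ∧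
        ∀ l, house (ξ l : K) ≤ (c : ℝ) ^ 2 * (Fintype.card β * A) := by
  have h : ∃ c : ℝ, ∀ {α : Type v} {β : Type w} [Fintype α] [Fintype β] (a : Matrix α β (𝓞 K)),
      a ≠ 0 → 0 < Fintype.card α → Fintype.card α < Fintype.card β → ∀ {A : ℝ},
      (∀ k l, house (a k l : K) ≤ A) → ∃ ξ : β → 𝓞 K, ξ ≠ 0 ∧ a.mulVec ξ = 0 ∧
        ∀ l, house (ξ l : K) ≤ c * (c * Fintype.card β * A) ^
          ((Fintype.card α : ℝ) / (Fintype.card β - Fintype.card α)) :=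
    ⟨_, fun {α β} _ _ a ha h0 h1 {A} hA =>
      house.exists_ne_zero_int_vec_house_le K a ha h0 h1 rfl hA rfl⟩
  obtain ⟨c, h⟩ := h
  obtain ⟨n, hn⟩ := exists_nat_ge (|c| + 1)
  refine ⟨n, fun {α β} _ _ a h0 h1 A hA hle => ?_⟩
  have hn1 : (1 : ℝ) ≤ n := by linarith [abs_nonneg c]
  have hq : (1 : ℝ) ≤ Fintype.card β := by exact_mod_cast (by omega : 1 ≤ Fintype.card β)
  have hX : (1 : ℝ) ≤ Fintype.card β * A := one_le_mul_of_one_le_of_one_le hq hA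
  have hX' : (1 : ℝ) ≤ n * (Fintype.card β * A) := one_le_mul_of_one_le_of_one_le hn1 hX
  rcases eq_or_ne a 0 with rfl | ha
  · have : Nonempty β := Fintype.card_pos_iff.1 (by omega)
    refine ⟨1, one_ne_zero, Matrix.zero_mulVec _, fun l => ?_⟩
    have : house ((1 : β → 𝓞 K) l : K) ≤ 1 :=
      house_le_of_forall_embedding fun ψ => by simp
    refine this.trans (one_le_mul_of_one_le_of_one_le (one_le_pow₀ hn1) hX)
  · obtain ⟨ξ, hξ, hmul, hbd⟩ := h a ha h0 (by clear h; omega) hle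
    refine ⟨ξ, hξ, hmul, fun l => (hbd l).trans ?_⟩
    have hexp0 : (0 : ℝ) ≤ (Fintype.card α : ℝ) / (Fintype.card β - Fintype.card α) := by
      refine div_nonneg (Nat.cast_nonneg _) (sub_nonneg.2 ?_)
      exact_mod_cast (by omega : Fintype.card α ≤ Fintype.card β)
    have hexp1 : (Fintype.card α : ℝ) / (Fintype.card β - Fintype.card α) ≤ 1 := by
      have h2 : (2 * Fintype.card α : ℝ) ≤ Fintype.card β := by exact_mod_cast h1
      have h3 : (0 : ℝ) < Fintype.card α := by exact_mod_cast h0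
      rw [div_le_one (by linarith)]
      linarith
    calc c * (c * Fintype.card β * A) ^ ((Fintype.card α : ℝ) / (Fintype.card β - Fintype.card α))
        ≤ |c| * |(c * Fintype.card β * A) ^
            ((Fintype.card α : ℝ) / (Fintype.card β - Fintype.card α))| := by
          rw [← abs_mul]; exact le_abs_self _
      _ ≤ n * (n * (Fintype.card β * A)) := by
          refine mul_le_mul (by linarith) ?_ (abs_nonneg _) (by linarith)
          refine (Real.abs_rpow_le_abs_rpow _ _).trans ?_
          refine (Real.rpow_le_rpow (abs_nonneg _) (z := _) (y := n * (Fintype.card β * A)) ?_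
            hexp0).trans ?_
          · rw [mul_assoc, abs_mul, abs_of_nonneg (zero_le_one.trans hX)]
            gcongr
            linarith
          · exact (Real.rpow_le_rpow_of_exponent_le hX' hexp1).trans (by rw [Real.rpow_one])
      _ = _ := by ring

/-- Monomials in `α` with bounded exponents have a common denominator, of controlled size. -/
theorem exists_denominator_monomials {K : Type*} [Field K] [NumberField K] {ι : Type*} [Fintype ι]
    (α : ι → K) :
    ∃ δ C₀ : ℕ, 1 ≤ δ ∧ ∀ C, C₀ ≤ C → ∀ (M : ℕ) (n : ι → ℤ), (∀ i, |n i| ≤ M) →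
      ∃ ε : 𝓞 K, (ε : K) = δ ^ (M * Fintype.card ι) * ∏ i, α i ^ n i ∧
        ∀ ψ : K →+* ℂ, ‖ψ ε‖ ≤ (C : ℝ) ^ (M * Fintype.card ι) := by
  classical
  have hden (x : K) : ∃ m : ℕ, 1 ≤ m ∧ IsIntegral ℤ ((m : K) * x) := by
    obtain ⟨m, hm, h⟩ := ((Algebra.IsAlgebraic.isAlgebraic (R := ℚ) x).isIntegral
      |>.exists_multiple_integral_of_isLocalization (nonZeroDivisors ℤ) (Rₘ := ℚ)) |> fun ⟨m, h⟩ =>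
        (⟨m.1, nonZeroDivisors.ne_zero m.2, h⟩ : ∃ m : ℤ, m ≠ 0 ∧ IsIntegral ℤ (m • x))
    refine ⟨m.natAbs, Int.natAbs_pos.2 hm, ?_⟩
    rcases Int.natAbs_eq m with h' | h'
    · rw [h', zsmul_eq_mul] at h
      simpa using h
    · rw [h', zsmul_eq_mul] at h
      simpa using h.neg
  choose m hm1 hm using hden
  set δ := (∏ i, m (α i)) * ∏ i, m (α i)⁻¹ with hδ
  have hδ1 : 1 ≤ δ := Nat.mul_pos (Finset.prod_pos fun i _ => hm1 _)
    (Finset.prod_pos fun i _ => hm1 _)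
  have hA (i : ι) : IsIntegral ℤ ((δ : K) * α i) := by
    obtain ⟨q, hq⟩ := (Finset.dvd_prod_of_mem (fun i => m (α i)) (Finset.mem_univ i)).mul_right
      (∏ i, m (α i)⁻¹)
    rw [hδ, hq]
    push_cast
    rw [mul_comm ((m (α i) : ℕ) : K), mul_assoc]
    exact (isIntegral_natCast q).mul (hm _)
  have hB (i : ι) : IsIntegral ℤ ((δ : K) * (α i)⁻¹) := by
    obtain ⟨q, hq⟩ := (Finset.dvd_prod_of_mem (fun i => m (α i)⁻¹) (Finset.mem_univ i)).mul_left
      (∏ i, m (α i))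
    rw [hδ, hq]
    push_cast
    rw [mul_comm ((m (α i)⁻¹ : ℕ) : K), mul_assoc]
    exact (isIntegral_natCast q).mul (hm _)
  obtain ⟨C₁, hC₁⟩ := exists_nat_forall_le fun p : ι × (K →+* ℂ) => ‖p.2 ((δ : K) * α p.1)‖
  obtain ⟨C₂, hC₂⟩ := exists_nat_forall_le fun p : ι × (K →+* ℂ) => ‖p.2 ((δ : K) * (α p.1)⁻¹)‖
  refine ⟨δ, C₁ + C₂ + δ, hδ1, fun C hC M n hn => ?_⟩
  have hC' : (C₁ + C₂ + δ : ℝ) ≤ C := by exact_mod_cast hC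
  have key (x : K) (k : ℕ) (hk : k ≤ M) (hx : IsIntegral ℤ ((δ : K) * x))
      (hx' : ∀ ψ : K →+* ℂ, ‖ψ ((δ : K) * x)‖ ≤ C) :
      IsIntegral ℤ ((δ : K) ^ M * x ^ k) ∧ ∀ ψ : K →+* ℂ, ‖ψ ((δ : K) ^ M * x ^ k)‖ ≤ C ^ M := by
    have e : (δ : K) ^ M * x ^ k = ((δ : K) * x) ^ k * (δ : K) ^ (M - k) := by
      rw [mul_pow, mul_right_comm, ← pow_add, Nat.add_sub_cancel' hk]
    rw [e]
    refine ⟨(hx.pow k).mul ((isIntegral_natCast δ).pow _), fun ψ => ?_⟩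
    rw [map_mul, map_pow, norm_mul, norm_pow, map_pow, norm_pow]
    calc ‖ψ ((δ : K) * x)‖ ^ k * ‖ψ (δ : K)‖ ^ (M - k) ≤ (C : ℝ) ^ k * (C : ℝ) ^ (M - k) := by
          gcongr
          · exact hx' ψ
          · simp only [map_natCast, RCLike.norm_natCast]
            linarith [Nat.cast_nonneg (α := ℝ) C₁, Nat.cast_nonneg (α := ℝ) C₂]
      _ = _ := by rw [← pow_add, Nat.add_sub_cancel' hk]
  have key' (i : ι) : IsIntegral ℤ ((δ : K) ^ M * α i ^ n i) ∧
      ∀ ψ : K →+* ℂ, ‖ψ ((δ : K) ^ M * α i ^ n i)‖ ≤ C ^ M := by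
    have hi := hn i
    rw [Int.abs_eq_natAbs] at hi
    rcases Int.natAbs_eq (n i) with h | h
    · rw [h, zpow_natCast]
      refine key _ _ (by omega) (hA i) fun ψ => (hC₁ (i, ψ)).trans ?_
      linarith [Nat.cast_nonneg (α := ℝ) C₂, Nat.cast_nonneg (α := ℝ) δ]
    · rw [h, zpow_neg, ← inv_zpow, zpow_natCast]
      refine key _ _ (by omega) (hB i) fun ψ => (hC₂ (i, ψ)).trans ?_
      linarith [Nat.cast_nonneg (α := ℝ) C₁, Nat.cast_nonneg (α := ℝ) δ]
  have e : (δ : K) ^ (M * Fintype.card ι) * ∏ i, α i ^ n i = ∏ i, ((δ : K) ^ M * α i ^ n i) := by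
    rw [Finset.prod_mul_distrib, Finset.prod_const, Finset.card_univ, pow_mul]
  have hprod : IsIntegral ℤ (∏ i, ((δ : K) ^ M * α i ^ n i)) :=
    IsIntegral.prod _ fun i _ => (key' i).1
  refine ⟨⟨∏ i, ((δ : K) ^ M * α i ^ n i), hprod⟩,
    e.symm, fun ψ => ?_⟩
  calc ‖ψ (∏ i, ((δ : K) ^ M * α i ^ n i))‖ = ∏ i, ‖ψ ((δ : K) ^ M * α i ^ n i)‖ := by
        rw [map_prod, norm_prod]
    _ ≤ ∏ _i : ι, (C : ℝ) ^ M := Finset.prod_le_prod (fun _ _ => norm_nonneg _)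
        fun i _ => (key' i).2 ψ
    _ = _ := by rw [Finset.prod_const, Finset.card_univ, pow_mul]

namespace AuxFun

open Polynomial

variable {K : Type*} [Field K] [NumberField K] (φ : K →+* ℂ) (μ : Gal(K/ℚ) → ℂ)

/-- The algebraic integer with coordinates `t` in the chosen integral basis. -/
noncomputable def boxSum (t : Module.Free.ChooseBasisIndex ℤ (𝓞 K) → ℕ) : 𝓞 K :=
  ∑ j, t j • RingOfIntegers.basis K j

/-- The vector of conjugates of an algebraic integer. -/
noncomputable def point : 𝓞 K →+ (Gal(K/ℚ) → ℂ) where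
  toFun x σ := φ (σ x)
  map_zero' := by ext; simp
  map_add' x y := by ext; simp

/-- The logarithm `∑ σ, μ σ * φ (σ x)` of the value of the exponential at the point `x`. -/
noncomputable def ell : 𝓞 K →+ ℂ where
  toFun x := ∑ σ, μ σ * φ (σ x)
  map_zero' := by simp
  map_add' x y := by simp [mul_add, Finset.sum_add_distrib]

/-- The action of an automorphism on algebraic integers. -/
noncomputable def conj (σ : Gal(K/ℚ)) : 𝓞 K →+* 𝓞 K :=
  RingOfIntegers.mapRingHom (σ : K →+* K)

theorem coe_conj (σ : Gal(K/ℚ)) (x : 𝓞 K) : (conj σ x : K) = σ x := rfl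

theorem norm_boxSum_le {t : Module.Free.ChooseBasisIndex ℤ (𝓞 K) → ℕ} {B : ℕ}
    (ht : ∀ j, t j < B) {E : Type*} [SeminormedAddCommGroup E] (f : 𝓞 K →+ E) {C : ℝ}
    (hC : ∀ j, ‖f (RingOfIntegers.basis K j)‖ ≤ C) :
    ‖f (boxSum t)‖ ≤ Module.finrank ℚ K * B * C := by
  rw [boxSum, map_sum]
  refine (norm_sum_le _ _).trans ?_
  calc ∑ j, ‖f (t j • RingOfIntegers.basis K j)‖
      ≤ ∑ _j : Module.Free.ChooseBasisIndex ℤ (𝓞 K), B * C := by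
        refine Finset.sum_le_sum fun j _ => ?_
        rw [map_nsmul]
        refine (norm_nsmul_le).trans ?_
        have : (t j : ℝ) ≤ B := by exact_mod_cast (ht j).le
        exact mul_le_mul this (hC j) (norm_nonneg _) (Nat.cast_nonneg _)
    _ = _ := by
        rw [Finset.sum_const, Finset.card_univ, ← Module.finrank_eq_card_chooseBasisIndex,
          RingOfIntegers.rank, nsmul_eq_mul, mul_assoc]

theorem boxSum_injective : Function.Injective (boxSum (K := K)) := by
  intro t s h
  funext j
  have e (t : Module.Free.ChooseBasisIndex ℤ (𝓞 K) → ℕ) :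
      (RingOfIntegers.basis K).repr (boxSum t) j = t j := by
    have := congrFun ((RingOfIntegers.basis K).repr_sum_self fun j => (t j : ℤ)) j
    simpa only [boxSum, natCast_zsmul] using this
  exact_mod_cast (e t).symm.trans ((congrArg (fun x => (RingOfIntegers.basis K).repr x j) h).trans
    (e s))

/-- The auxiliary function. -/
noncomputable def auxFun {L : ℕ}
    (p : Fin L × (Module.Free.ChooseBasisIndex ℤ (𝓞 K) → Fin L) → 𝓞 K) :
    ExpPoly (Gal(K/ℚ) → ℂ) (Fin L × (Module.Free.ChooseBasisIndex ℤ (𝓞 K) → Fin L)) where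
  coeff i := φ (p i)
  deg i := i.1
  χ := LinearMap.proj 1
  ω i := ∑ σ, (μ σ * φ (σ (boxSum fun j => (i.2 j : ℕ)))) • LinearMap.proj σ

section

variable {L : ℕ} (p : Fin L × (Module.Free.ChooseBasisIndex ℤ (𝓞 K) → Fin L) → 𝓞 K)
  (i : Fin L × (Module.Free.ChooseBasisIndex ℤ (𝓞 K) → Fin L))

theorem auxFun_χ_point (x : 𝓞 K) : (auxFun φ μ p).χ (point φ x) = φ x := by
  simp [auxFun, point]

theorem auxFun_ω_point (x : 𝓞 K) :
    (auxFun φ μ p).ω i (point φ x) = ell φ μ (x * boxSum fun j => (i.2 j : ℕ)) := by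
  simp only [auxFun, point, ell, LinearMap.coe_sum, LinearMap.smul_apply, LinearMap.proj_apply,
    Finset.sum_apply, AddMonoidHom.coe_mk, ZeroHom.coe_mk, smul_eq_mul, map_mul]
  exact Finset.sum_congr rfl fun σ _ => by ring

/-- Growth of the derivatives of the auxiliary function along a line. -/
theorem norm_value_auxFun_le {C H : ℕ} (hC : 1 ≤ C) (hH : 1 ≤ H) (hL : 1 ≤ L)
    (hbasis : ∀ (ψ : K →+* ℂ) j, ‖ψ (RingOfIntegers.basis K j)‖ ≤ C)
    (hell : ∀ j j', ‖ell φ μ (RingOfIntegers.basis K j * RingOfIntegers.basis K j')‖ ≤ C)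
    {P : ℝ} (hp : ∀ i, ‖φ (p i)‖ ≤ P) {t : Module.Free.ChooseBasisIndex ℤ (𝓞 K) → ℕ}
    (ht : ∀ j, t j < H) {κ : Type*} (s : Finset κ) (r : κ → Module.Free.ChooseBasisIndex ℤ (𝓞 K))
    {T : ℕ} (hT : s.card ≤ T) (j : Module.Free.ChooseBasisIndex ℤ (𝓞 K)) {R : ℝ} {z : ℂ}
    (hz : ‖z‖ ≤ R) :
    ‖(auxFun φ μ p).value (point φ (boxSum t) + z • point φ (RingOfIntegers.basis K j))
        (∏ l ∈ s, (auxFun φ μ p).symbol (point φ (RingOfIntegers.basis K (r l))))‖ ≤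
      L ^ (Module.finrank ℚ K + 1) * (P * ((2 * Module.finrank ℚ K * L * C) ^ T *
        ((Module.finrank ℚ K * H * C + R * C) ^ L *
        Real.exp (Module.finrank ℚ K ^ 2 * H * L * C + R * (Module.finrank ℚ K * L * C))))) := by
  set d := Module.finrank ℚ K with hd
  have hd1 : (1 : ℝ) ≤ d := by exact_mod_cast (Module.finrank_pos : 0 < Module.finrank ℚ K)
  have hC' : (1 : ℝ) ≤ C := by exact_mod_cast hC
  have hH' : (1 : ℝ) ≤ H := by exact_mod_cast hH
  have hL' : (1 : ℝ) ≤ L := by exact_mod_cast hL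
  have hR : 0 ≤ R := (norm_nonneg z).trans hz
  have hρ : (1 : ℝ) ≤ d * H * C + R * C := by
    have := one_le_mul_of_one_le_of_one_le (one_le_mul_of_one_le_of_one_le hd1 hH') hC'
    have : 0 ≤ R * C := by positivity
    linarith
  have hdLC : (1 : ℝ) ≤ d * L * C := one_le_mul_of_one_le_of_one_le
    (one_le_mul_of_one_le_of_one_le hd1 hL') hC'
  have hell' (i : Fin L × (Module.Free.ChooseBasisIndex ℤ (𝓞 K) → Fin L)) (j) :
      ‖ell φ μ (RingOfIntegers.basis K j * boxSum fun j => (i.2 j : ℕ))‖ ≤ d * L * C :=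
    norm_boxSum_le (fun j => (i.2 j).2)
      ((ell φ μ).comp (AddMonoidHom.mulLeft (RingOfIntegers.basis K j))) fun j' => hell j j'
  have hterm (i : Fin L × (Module.Free.ChooseBasisIndex ℤ (𝓞 K) → Fin L)) :
      ‖(auxFun φ μ p).coeff i * ((diffAct ((∏ l ∈ s, (auxFun φ μ p).symbol
          (point φ (RingOfIntegers.basis K (r l)))) i) (X ^ (auxFun φ μ p).deg i)).eval
          ((auxFun φ μ p).χ (point φ (boxSum t) + z • point φ (RingOfIntegers.basis K j))) *
          Complex.exp ((auxFun φ μ p).ω i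
            (point φ (boxSum t) + z • point φ (RingOfIntegers.basis K j))))‖ ≤
      P * ((2 * d * L * C) ^ T * ((d * H * C + R * C) ^ L *
        Real.exp (d ^ 2 * H * L * C + R * (d * L * C)))) := by
    rw [norm_mul, norm_mul, ← mul_assoc ((2 * d * L * C : ℝ) ^ T)]
    have hi : (((auxFun φ μ p).deg i : ℕ) : ℝ) ≤ L := by exact_mod_cast i.1.2.le
    refine mul_le_mul (hp i) ?_ (by positivity) ((norm_nonneg _).trans (hp i))
    refine mul_le_mul ?_ ?_ (norm_nonneg _) (by positivity)
    · rw [Finset.prod_apply]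
      simp only [ExpPoly.symbol_apply]
      refine (diffAct.norm_eval_prod_le s _ _ (D := 2 * d * L * C) hρ (fun l _ => ?_) ?_).trans ?_
      · rw [auxFun_ω_point, auxFun_χ_point]
        have h1 := hell' i (r l)
        have h3 : ((auxFun φ μ p).deg i : ℕ) * ‖φ (RingOfIntegers.basis K (r l))‖ ≤
            (L : ℝ) * C := by
          gcongr
          exact hbasis φ _
        have h4 : 1 * ((L : ℝ) * C) ≤ d * (L * C) := by gcongr
        linarith
      · rw [map_add, map_smul, auxFun_χ_point, auxFun_χ_point, smul_eq_mul]
        refine (norm_add_le _ _).trans (add_le_add ?_ ?_)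
        · exact norm_boxSum_le ht (φ.comp (algebraMap (𝓞 K) K)).toAddMonoidHom fun j => hbasis φ j
        · rw [norm_mul]
          exact mul_le_mul hz (hbasis φ j) (norm_nonneg _) hR
      · refine mul_le_mul (pow_le_pow_right₀ (by linarith) hT)
          (pow_le_pow_right₀ hρ i.1.2.le) (by positivity) (by positivity)
    · rw [Complex.norm_exp]
      refine Real.exp_le_exp.2 ((Complex.re_le_norm _).trans ?_)
      rw [map_add, map_smul, auxFun_ω_point, auxFun_ω_point, smul_eq_mul]
      refine (norm_add_le _ _).trans (add_le_add ?_ ?_)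
      · have := norm_boxSum_le ht ((ell φ μ).comp
          (AddMonoidHom.mulRight (boxSum fun j => (i.2 j : ℕ)))) fun j' => hell' i j'
        refine this.trans (le_of_eq ?_)
        ring
      · rw [norm_mul]
        exact mul_le_mul hz (hell' i j) (norm_nonneg _) hR
  rw [ExpPoly.value_apply]
  refine (norm_sum_le _ _).trans ((Finset.sum_le_sum fun i _ => hterm i).trans (le_of_eq ?_))
  rw [Finset.sum_const, Finset.card_univ, nsmul_eq_mul]
  congr 1
  simp only [Fintype.card_prod, Fintype.card_fin, Fintype.card_pi, Finset.prod_const,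
    Finset.card_univ, ← Module.finrank_eq_card_chooseBasisIndex, RingOfIntegers.rank, ← hd]
  push_cast
  ring

variable [DecidableEq Gal(K/ℚ)]

theorem auxFun_ω_single (σ : Gal(K/ℚ)) :
    (auxFun φ μ p).ω i (Pi.single σ 1) = μ σ * φ (σ (boxSum fun j => (i.2 j : ℕ))) := by
  simp [auxFun, Pi.single_apply]

/-- The symbol of the normalised derivation attached to the automorphism `σ`, at the
frequency `b`. -/
noncomputable def algSymbol (b : 𝓞 K) (σ : Gal(K/ℚ)) : (𝓞 K)[X] :=
  C (conj σ b) + C (if σ = 1 then 1 else 0) * X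

/-- The coefficients of the linear system. -/
noncomputable def algEntry {κ : Type*} [Fintype κ] (x : 𝓞 K) (τ : κ → Gal(K/ℚ)) (ε : 𝓞 K) : 𝓞 K :=
  (diffAct (∏ l, algSymbol (boxSum fun j => (i.2 j : ℕ)) (τ l)) (X ^ (i.1 : ℕ))).eval x * ε

theorem map_algEntry {κ : Type*} [Fintype κ] (x : 𝓞 K) (τ : κ → Gal(K/ℚ)) (ε : 𝓞 K)
    (ψ : K →+* ℂ) :
    ψ (algEntry i x τ ε) = (diffAct (∏ l, (C (ψ (τ l (boxSum fun j => (i.2 j : ℕ)))) +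
      C (if τ l = 1 then 1 else 0) * X)) (X ^ (i.1 : ℕ))).eval (ψ x) * ψ ε := by
  have h := diffAct.map (ψ.comp (algebraMap (𝓞 K) K))
    (∏ l, algSymbol (boxSum fun j => (i.2 j : ℕ)) (τ l)) (X ^ (i.1 : ℕ))
  rw [Polynomial.map_prod, Polynomial.map_pow, map_X] at h
  have h' : ∀ l, (algSymbol (boxSum fun j => (i.2 j : ℕ)) (τ l)).map
      (ψ.comp (algebraMap (𝓞 K) K)) = C (ψ (τ l (boxSum fun j => (i.2 j : ℕ)))) +
      C (if τ l = 1 then 1 else 0) * X := by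
    intro l
    rw [algSymbol]
    by_cases hl : τ l = 1
    · simp [hl, coe_conj]
    · simp [hl, coe_conj]
  simp only [h'] at h
  rw [← h]
  change _ = eval ((ψ.comp (algebraMap (𝓞 K) K)) x) _ * _
  rw [eval_map_apply, algEntry]
  simp

/-- The derivatives of the auxiliary function at points of the lattice are algebraic, up to
known factors. -/
theorem value_auxFun (hμ : μ 1 = 1) {κ : Type*} [Fintype κ] (x : 𝓞 K) (τ : κ → Gal(K/ℚ))
    (ε : Fin L × (Module.Free.ChooseBasisIndex ℤ (𝓞 K) → Fin L) → 𝓞 K) (D : ℂ)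
    (hε : ∀ i, φ (ε i) = D * Complex.exp (ell φ μ (x * boxSum fun j => (i.2 j : ℕ)))) :
    D * (auxFun φ μ p).value (point φ x) (∏ l, (auxFun φ μ p).symbol (Pi.single (τ l) 1)) =
      (∏ l, μ (τ l)) * φ (∑ i, algEntry i x τ (ε i) * p i : 𝓞 K) := by
  rw [ExpPoly.value_apply]
  push_cast
  rw [map_sum, Finset.mul_sum, Finset.mul_sum]
  refine Finset.sum_congr rfl fun i _ => ?_
  have hs : (∏ l, (auxFun φ μ p).symbol (Pi.single (τ l) 1)) i = (∏ l, μ (τ l)) •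
      ∏ l, (C (φ (τ l (boxSum fun j => (i.2 j : ℕ)))) + C (if τ l = 1 then 1 else 0) * X) := by
    rw [Finset.prod_apply, ← Finset.prod_smul]
    refine Finset.prod_congr rfl fun l _ => ?_
    rw [ExpPoly.symbol_apply, auxFun_ω_single, smul_eq_C_mul, C_mul]
    by_cases hl : τ l = 1
    · simp [hl, auxFun, hμ]
    · simp [hl, auxFun, Ne.symm hl]
  rw [hs, diffAct.smul_left, eval_smul, smul_eq_mul, map_mul, map_algEntry, hε, auxFun_χ_point,
    auxFun_ω_point]
  change D * (φ (p i) * _) = _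
  change D * (φ (p i) * (_ * eval _ (diffAct _ (X ^ (i.1 : ℕ))) * _)) = _
  ring

/-- Size of the coefficients of the linear system. -/
theorem norm_algEntry_le {C r H : ℕ} (hC : 1 ≤ C) (hH : 1 ≤ H) (hL : 1 ≤ L)
    (hbasis : ∀ (ψ : K →+* ℂ) j, ‖ψ (RingOfIntegers.basis K j)‖ ≤ C)
    {t : Module.Free.ChooseBasisIndex ℤ (𝓞 K) → ℕ} (ht : ∀ j, t j < H)
    {κ : Type*} [Fintype κ] (τ : κ → Gal(K/ℚ)) (ε : 𝓞 K) (ψ : K →+* ℂ)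
    (hε : ‖ψ ε‖ ≤ (C : ℝ) ^ (Module.finrank ℚ K ^ 2 * H * L * C * r)) :
    ‖ψ (algEntry i (boxSum t) τ ε)‖ ≤
      entryBound (Module.finrank ℚ K) C r H L (Fintype.card κ) := by
  set d := Module.finrank ℚ K with hd
  have hd1 : (1 : ℝ) ≤ d := by exact_mod_cast (Module.finrank_pos : 0 < Module.finrank ℚ K)
  have hC' : (1 : ℝ) ≤ C := by exact_mod_cast hC
  have hH' : (1 : ℝ) ≤ H := by exact_mod_cast hH
  have hL' : (1 : ℝ) ≤ L := by exact_mod_cast hL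
  have hρ : (1 : ℝ) ≤ d * H * C := one_le_mul_of_one_le_of_one_le
      (one_le_mul_of_one_le_of_one_le hd1 hH') hC'
  have hdC : (1 : ℝ) ≤ d * C := one_le_mul_of_one_le_of_one_le hd1 hC'
  rw [map_algEntry, norm_mul, entryBound, ← mul_assoc]
  refine mul_le_mul ?_ hε (norm_nonneg _) (by positivity)
  have hx : ‖ψ (boxSum t)‖ ≤ d * H * C :=
    norm_boxSum_le ht (ψ.comp (algebraMap (𝓞 K) K)).toAddMonoidHom fun j => hbasis ψ j
  have hi : ((i.1 : ℕ) : ℝ) ≤ L := by exact_mod_cast i.1.2.le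
  refine (diffAct.norm_eval_prod_le Finset.univ _ _ (D := 2 * d * L * C) hρ (fun l _ => ?_)
    hx).trans ?_
  · have h1 : ‖ψ (τ l (boxSum fun j => (i.2 j : ℕ)))‖ ≤ d * L * C :=
      norm_boxSum_le (fun j => (i.2 j).2)
        ((ψ.comp (τ l : K →+* K)).comp (algebraMap (𝓞 K) K)).toAddMonoidHom
        fun j => hbasis (ψ.comp (τ l : K →+* K)) j
    have h2 : ‖(if τ l = 1 then 1 else 0 : ℂ)‖ ≤ 1 := by split_ifs <;> simp
    have h3 : (i.1 : ℕ) * ‖(if τ l = 1 then 1 else 0 : ℂ)‖ ≤ (L : ℝ) * 1 := by gcongr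
    have h4 : (L : ℝ) * 1 ≤ L * (d * C) := by gcongr
    linarith
  · rw [Finset.card_univ]
    gcongr
    exact i.1.2.le

end

end AuxFun

namespace AuxFun

variable {K : Type} [Field K] [NumberField K] (φ : K →+* ℂ) (μ : Gal(K/ℚ) → ℂ)

theorem span_point : Submodule.span ℂ
    (Set.range fun j => point φ (RingOfIntegers.basis K j)) = ⊤ := by
  classical
  by_contra hne
  obtain ⟨f, hf, hle⟩ := Submodule.exists_le_ker_of_lt_top _ (lt_top_iff_ne_top.2 hne)
  let ev (σ : Gal(K/ℚ)) : 𝓞 K →* ℂ := (φ.comp (σ : K →+* K)).comp (algebraMap (𝓞 K) K)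
  have hev : Function.Injective ev := by
    intro σ τ h
    refine AlgEquiv.ext fun x => φ.injective ?_
    have : φ.comp (σ : K →+* K) = φ.comp (τ : K →+* K) :=
      IsLocalization.ringHom_ext (nonZeroDivisors (𝓞 K))
        (RingHom.ext fun y => DFunLike.congr_fun h y)
    exact DFunLike.congr_fun this x
  have hlin := Fintype.linearIndependent_iff.1
    ((linearIndependent_monoidHom (𝓞 K) ℂ).comp ev hev) (fun σ => f (Pi.single σ 1)) ?_
  · refine hf (LinearMap.pi_ext' fun σ => LinearMap.ext_ring ?_)
    simpa using hlin σ
  · have hzero : ∀ x : 𝓞 K, f (point φ x) = 0 := by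
      intro x
      have hb : ∀ j, f (point φ (RingOfIntegers.basis K j)) = 0 := fun j =>
        hle (Submodule.subset_span ⟨j, rfl⟩)
      rw [← (RingOfIntegers.basis K).sum_repr x, map_sum, map_sum]
      refine Finset.sum_eq_zero fun j _ => ?_
      rw [map_zsmul, map_zsmul, hb, smul_zero]
    funext x
    rw [Finset.sum_apply, Pi.zero_apply, ← hzero x,
      show point φ x = ∑ σ, point φ x σ • Pi.single σ (1 : ℂ) from
        pi_eq_sum_univ' (point φ x) |>.trans (by simp), map_sum]
    refine Finset.sum_congr rfl fun σ _ => ?_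
    rw [map_smul, smul_eq_mul, Pi.smul_apply, smul_eq_mul, mul_comm]
    rfl

open scoped Classical in
theorem exists_coeff_point : ∃ c : Gal(K/ℚ) → Module.Free.ChooseBasisIndex ℤ (𝓞 K) → ℂ,
    ∀ σ, (Pi.single σ 1 : Gal(K/ℚ) → ℂ) = ∑ j, c σ j • point φ (RingOfIntegers.basis K j) := by
  have (σ : Gal(K/ℚ)) := Submodule.mem_span_range_iff_exists_fun ℂ |>.1
    ((span_point φ).symm ▸ Submodule.mem_top : (Pi.single σ 1 : Gal(K/ℚ) → ℂ) ∈ _)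
  choose c hc using this
  exact ⟨c, fun σ => (hc σ).symm⟩

theorem point_boxSum (t : Module.Free.ChooseBasisIndex ℤ (𝓞 K) → ℕ) :
    point φ (boxSum t) = ∑ j, t j • point φ (RingOfIntegers.basis K j) := by
  simp only [boxSum, map_sum, map_nsmul]

theorem card_index (L : ℕ) :
    Fintype.card (Fin L × (Module.Free.ChooseBasisIndex ℤ (𝓞 K) → Fin L)) =
      L ^ (Module.finrank ℚ K + 1) := by
  simp only [Fintype.card_prod, Fintype.card_fin, Fintype.card_pi, Finset.prod_const,
    Finset.card_univ, ← Module.finrank_eq_card_chooseBasisIndex, RingOfIntegers.rank]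
  ring

theorem two_mul_le_auxDegree_pow (d : ℕ) {H : ℕ} (hH : 1 ≤ H) (N : ℕ) :
    2 * (H ^ d * (N ^ (d + 1)) ^ d) ≤ auxDegree d H N ^ (d + 1) := by
  calc 2 * (H ^ d * (N ^ (d + 1)) ^ d) = 2 ^ 1 * (H ^ d * (N ^ d) ^ (d + 1)) := by
        rw [← pow_mul, ← pow_mul, mul_comm d (d + 1), pow_one]
    _ ≤ 2 ^ (d + 1) * (H ^ (d + 1) * (N ^ d) ^ (d + 1)) := by
        gcongr
        · norm_num
        · omega
        · omega
    _ = _ := by rw [auxDegree, mul_pow, mul_pow, mul_assoc]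

theorem entryBound_mono {d C r H L t t' : ℕ} (h : 1 ≤ d * L * C) (ht : t ≤ t') :
    entryBound d C r H L t ≤ entryBound d C r H L t' := by
  have : (1 : ℝ) ≤ d * L * C := by exact_mod_cast h
  rw [entryBound, entryBound]
  gcongr
  linarith

theorem one_le_entryBound {d C r H L t : ℕ} (h : 1 ≤ d * L * C) (h' : 1 ≤ d * H * C)
    (hC : 1 ≤ C) : 1 ≤ entryBound d C r H L t := by
  have h1 : (1 : ℝ) ≤ d * L * C := by exact_mod_cast h
  have h2 : (1 : ℝ) ≤ d * H * C := by exact_mod_cast h'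
  have h3 : (1 : ℝ) ≤ C := by exact_mod_cast hC
  exact one_le_mul_of_one_le_of_one_le (one_le_pow₀ (by linarith))
    (one_le_mul_of_one_le_of_one_le (one_le_pow₀ h2) (one_le_pow₀ h3))

open scoped Classical in
/-- Construction of the auxiliary function. -/
theorem exists_auxFun [IsGalois ℚ K] (hμ : μ 1 = 1) {c C r H N : ℕ} (hc : c ≤ C) (hC : 1 ≤ C)
    (hH : 1 ≤ H) (hN : 1 ≤ N)
    (hsiegel : ∀ {α β : Type} [Fintype α] [Fintype β] (a : Matrix α β (𝓞 K)),
      0 < Fintype.card α → 2 * Fintype.card α ≤ Fintype.card β → ∀ {A : ℝ}, 1 ≤ A →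
      (∀ k l, house (a k l : K) ≤ A) → ∃ ξ : β → 𝓞 K, ξ ≠ 0 ∧ a.mulVec ξ = 0 ∧
        ∀ l, house (ξ l : K) ≤ (c : ℝ) ^ 2 * (Fintype.card β * A))
    (hbasis : ∀ (ψ : K →+* ℂ) j, ‖ψ (RingOfIntegers.basis K j)‖ ≤ C)
    {L : ℕ} (hL : L = auxDegree (Module.finrank ℚ K) H N)
    {D : ℂ} (hD : D ≠ 0) (ε : (Module.Free.ChooseBasisIndex ℤ (𝓞 K) → Fin H) →
      (Module.Free.ChooseBasisIndex ℤ (𝓞 K) → Fin L) → 𝓞 K)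
    (hε : ∀ t s, φ (ε t s) = D * Complex.exp (ell φ μ
      ((boxSum fun j => (t j : ℕ)) * boxSum fun j => (s j : ℕ))))
    (hε' : ∀ t s (ψ : K →+* ℂ), ‖ψ (ε t s)‖ ≤ (C : ℝ) ^ (Module.finrank ℚ K ^ 2 * H * L * C * r)) :
    ∃ p : Fin L × (Module.Free.ChooseBasisIndex ℤ (𝓞 K) → Fin L) → 𝓞 K, p ≠ 0 ∧
      (∀ i, house (p i : K) ≤ coeffBound (Module.finrank ℚ K) C r H N) ∧
      ∀ (t : Module.Free.ChooseBasisIndex ℤ (𝓞 K) → Fin H),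
        ∀ n < N ^ (Module.finrank ℚ K + 1), ∀ τ : Fin n → Gal(K/ℚ),
        (auxFun φ μ p).value (point φ (boxSum fun j => (t j : ℕ)))
          (∏ l, (auxFun φ μ p).symbol (Pi.single (τ l) 1)) = 0 := by
  set d := Module.finrank ℚ K with hd
  have hd1 : 1 ≤ d := Module.finrank_pos
  have hL1 : 1 ≤ L := by
    rw [hL, auxDegree]
    exact Nat.mul_pos (by omega) (pow_pos (by omega) _)
  have hT0 : 0 < N ^ (d + 1) := pow_pos (by omega) _
  have hdLC : 1 ≤ d * L * C := Nat.mul_pos (Nat.mul_pos hd1 hL1) hC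
  have hdHC : 1 ≤ d * H * C := Nat.mul_pos (Nat.mul_pos hd1 hH) hC
  have hcardG : Fintype.card Gal(K/ℚ) = d := by
    rw [← Nat.card_eq_fintype_card, IsGalois.card_aut_eq_finrank]
  have hcardJ : Fintype.card (Module.Free.ChooseBasisIndex ℤ (𝓞 K)) = d := by
    rw [← Module.finrank_eq_card_chooseBasisIndex, RingOfIntegers.rank]
  have hcardα : Fintype.card ((Module.Free.ChooseBasisIndex ℤ (𝓞 K) → Fin H) ×
      (Gal(K/ℚ) → Fin (N ^ (d + 1)))) = H ^ d * (N ^ (d + 1)) ^ d := by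
    simp only [Fintype.card_prod, Fintype.card_pi, Fintype.card_fin, Finset.prod_const,
      Finset.card_univ, hcardG, hcardJ]
  let a : Matrix ((Module.Free.ChooseBasisIndex ℤ (𝓞 K) → Fin H) ×
      (Gal(K/ℚ) → Fin (N ^ (d + 1))))
      (Fin L × (Module.Free.ChooseBasisIndex ℤ (𝓞 K) → Fin L)) (𝓞 K) := fun k i =>
    algEntry i (boxSum fun j => (k.1 j : ℕ))
      (fun l : Σ σ : Gal(K/ℚ), Fin (k.2 σ) => l.1) (ε k.1 i.2)
  obtain ⟨p, hp0, hp, hpb⟩ := hsiegel a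
    (by rw [hcardα]; positivity)
    (by rw [hcardα, card_index, ← hd, hL]; exact two_mul_le_auxDegree_pow d hH N)
    (one_le_entryBound (r := r) (t := d * N ^ (d + 1)) hdLC hdHC hC)
    (fun k i => house_le_of_forall_embedding fun ψ =>
      (norm_algEntry_le i hC hH hL1 hbasis (fun j => (k.1 j).2) _ (ε k.1 i.2) ψ
        (hε' k.1 i.2 ψ)).trans (entryBound_mono hdLC (by
          rw [Fintype.card_sigma]
          calc ∑ σ, Fintype.card (Fin (k.2 σ)) ≤ ∑ _σ : Gal(K/ℚ), N ^ (d + 1) :=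
                Finset.sum_le_sum fun σ _ => by simp
            _ = d * N ^ (d + 1) := by simp [hcardG])))
  refine ⟨p, hp0, fun i => (hpb i).trans ?_, fun t n hn τ => ?_⟩
  · rw [coeffBound, card_index, ← hd, hL]
    have hc' : (c : ℝ) ≤ C := by exact_mod_cast hc
    have : 0 ≤ entryBound d C r H (auxDegree d H N) (d * N ^ (d + 1)) := by
      rw [entryBound]; positivity
    push_cast
    gcongr
  · have hcard (σ : Gal(K/ℚ)) : (Finset.univ.filter fun l => τ l = σ).card < N ^ (d + 1) :=
      ((Finset.card_filter_le _ _).trans (by simp)).trans_lt hn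
    have hprod : ∏ l, (auxFun φ μ p).symbol (Pi.single (τ l) 1) =
        ∏ l : Σ σ : Gal(K/ℚ), Fin (Finset.univ.filter fun l => τ l = σ).card,
          (auxFun φ μ p).symbol (Pi.single l.1 1) := by
      rw [Fintype.prod_sigma]
      simp only [Finset.prod_const, Finset.card_univ, Fintype.card_fin]
      rw [← Finset.prod_fiberwise Finset.univ τ]
      refine Finset.prod_congr rfl fun σ _ => ?_
      rw [← Finset.prod_const]
      exact Finset.prod_congr rfl fun l hl => by rw [(Finset.mem_filter.1 hl).2]
    have := value_auxFun φ μ p hμ (boxSum fun j => (t j : ℕ))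
      (fun l : Σ σ : Gal(K/ℚ), Fin (Finset.univ.filter fun l => τ l = σ).card => l.1)
      (fun i => ε t i.2) D fun i => hε t i.2
    rw [← hprod] at this
    have hz : (∑ i, algEntry i (boxSum fun j => (t j : ℕ))
      (fun l : Σ σ : Gal(K/ℚ), Fin (Finset.univ.filter fun l => τ l = σ).card => l.1)
      (ε t i.2) * p i) = 0 := congrFun hp (t, fun σ => ⟨_, hcard σ⟩)
    rw [hz] at this
    simpa [hD] using this

end AuxFun

theorem exists_pow_le_lt (k : ℕ) {N T : ℕ} (hN : 1 ≤ N) (hT : N ^ (k + 1) ≤ T) :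
    ∃ R, N ≤ R ∧ R ^ (k + 1) ≤ T ∧ T ≤ (2 * R) ^ (k + 1) := by
  classical
  have hb : N ≤ T := (Nat.le_self_pow (by omega) N).trans hT
  refine ⟨Nat.findGreatest (fun R => R ^ (k + 1) ≤ T) T, Nat.le_findGreatest hb hT,
    Nat.findGreatest_spec (P := fun R => R ^ (k + 1) ≤ T) hb hT, ?_⟩
  set R := Nat.findGreatest (fun R => R ^ (k + 1) ≤ T) T with hR
  have hNR : N ≤ R := Nat.le_findGreatest hb hT
  have h : T < (R + 1) ^ (k + 1) := by
    by_contra! hle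
    have := Nat.le_findGreatest (P := fun R => R ^ (k + 1) ≤ T)
      ((Nat.le_self_pow (by omega) (R + 1)).trans hle) hle
    omega
  exact h.le.trans (Nat.pow_le_pow_left (by omega) _)

theorem one_le_norm_mul_pow {K : Type*} [Field K] [NumberField K] (φ : K →+* ℂ) {x : 𝓞 K}
    (hx : x ≠ 0) {B : ℝ} (hB : house (x : K) ≤ B) :
    1 ≤ B ^ Module.finrank ℚ K * ‖φ x‖ := by
  have h1 : (1 : ℝ) ≤ house (x : K) := one_le_house_of_isIntegral x.2 (by simpa using hx)
  have h2 : (1 : ℝ) ≤ ‖Algebra.norm ℚ (x : K)‖ := by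
    have h0 : Algebra.norm ℤ x ≠ 0 := by
      simpa using hx
    rw [← Algebra.coe_norm_int]
    have : (1 : ℤ) ≤ |Algebra.norm ℤ x| := Int.one_le_abs h0
    have h3 : (1 : ℝ) ≤ |(Algebra.norm ℤ x : ℝ)| := by exact_mod_cast this
    simpa [Int.norm_eq_abs] using h3
  calc (1 : ℝ) ≤ ‖φ x‖ * house (x : K) ^ (Module.finrank ℚ K - 1) :=
        h2.trans (norm_norm_le_norm_mul_house_pow _ _)
    _ ≤ ‖φ x‖ * B ^ Module.finrank ℚ K := by
        gcongr
        calc house (x : K) ^ (Module.finrank ℚ K - 1) ≤ house (x : K) ^ Module.finrank ℚ K :=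
              pow_le_pow_right₀ h1 (Nat.sub_le _ _)
          _ ≤ _ := by gcongr
    _ = _ := mul_comm _ _

namespace AuxFun

variable {K : Type} [Field K] [NumberField K] (φ : K →+* ℂ) (μ : Gal(K/ℚ) → ℂ)

open scoped Classical in
/-- Not all derivatives of a nonzero auxiliary function vanish at the origin. -/
theorem exists_value_ne_zero (hμ : μ 1 = 1) {L : ℕ}
    {p : Fin L × (Module.Free.ChooseBasisIndex ℤ (𝓞 K) → Fin L) → 𝓞 K} (hp : p ≠ 0) :
    ∃ n, ∃ τ : Fin n → Gal(K/ℚ), (auxFun φ μ p).value 0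
      (∏ l, (auxFun φ μ p).symbol (Pi.single (τ l) 1)) ≠ 0 := by
  by_contra! h
  refine hp ?_
  have hb : Function.Injective fun s : Module.Free.ChooseBasisIndex ℤ (𝓞 K) → Fin L =>
      φ (boxSum fun j => (s j : ℕ)) := by
    intro s s' hs
    have := boxSum_injective (RingOfIntegers.coe_injective (φ.injective hs))
    funext j
    exact Fin.ext (congrFun this j)
  have := ExpPoly.coeff_eq_zero_of_value_pow (auxFun φ μ p) (fun _ => rfl) (Pi.single 1 1)
    (by simp [auxFun]) _ hb (fun i => by rw [auxFun_ω_single, hμ]; simp)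
    (fun n => by simpa using h n fun _ => 1)
  funext i
  have hi : φ (p i) = 0 := congrFun this i
  simpa using hi

/-- The transcendence argument: there are no complex numbers `μ σ` with `μ 1 = 1` such that the
exponentials of `∑ σ, μ σ * φ (σ x)`, for `x` an algebraic integer, lie in a finitely generated
multiplicative group of algebraic numbers. -/
theorem not_exists_denominators [IsGalois ℚ K] (hμ : μ 1 = 1) {δ r C₀ : ℕ} (hδ : 1 ≤ δ)
    (hε : ∀ C, C₀ ≤ C → ∀ (H L : ℕ) (t s : Module.Free.ChooseBasisIndex ℤ (𝓞 K) → ℕ),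
      (∀ j, t j < H) → (∀ j, s j < L) → ∃ ε : 𝓞 K,
        φ ε = (δ : ℂ) ^ (Module.finrank ℚ K ^ 2 * H * L * C * r) *
          Complex.exp (ell φ μ (boxSum t * boxSum s)) ∧
        ∀ ψ : K →+* ℂ, ‖ψ ε‖ ≤ (C : ℝ) ^ (Module.finrank ℚ K ^ 2 * H * L * C * r)) : False := by
  classical
  set d := Module.finrank ℚ K with hd
  have hd1 : 1 ≤ d := Module.finrank_pos
  have hcardJ : Fintype.card (Module.Free.ChooseBasisIndex ℤ (𝓞 K)) = d := by
    rw [← Module.finrank_eq_card_chooseBasisIndex, RingOfIntegers.rank]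
  have hJ : Nonempty (Module.Free.ChooseBasisIndex ℤ (𝓞 K)) := Fintype.card_pos_iff.1 (by omega)
  obtain ⟨c, hsiegel⟩ := exists_siegel_constant.{0, 0, 0} K
  obtain ⟨q, hq⟩ := exists_coeff_point φ
  obtain ⟨C₁, hC₁⟩ := exists_nat_forall_le
    fun x : (K →+* ℂ) × Module.Free.ChooseBasisIndex ℤ (𝓞 K) => ‖x.1 (RingOfIntegers.basis K x.2)‖
  obtain ⟨C₂, hC₂⟩ := exists_nat_forall_le
    fun x : Module.Free.ChooseBasisIndex ℤ (𝓞 K) × Module.Free.ChooseBasisIndex ℤ (𝓞 K) =>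
      ‖ell φ μ (RingOfIntegers.basis K x.1 * RingOfIntegers.basis K x.2)‖
  obtain ⟨C₃, hC₃⟩ := exists_nat_forall_le fun σ => ‖(μ σ)⁻¹‖
  obtain ⟨C₄, hC₄⟩ := exists_nat_forall_le
    fun x : Gal(K/ℚ) × Module.Free.ChooseBasisIndex ℤ (𝓞 K) => ‖q x.1 x.2‖
  set C := C₀ + c + C₁ + C₂ + C₃ + C₄ + δ with hC
  have hCle (i : ℕ) (h : i ≤ C) : (i : ℝ) ≤ C := by exact_mod_cast h
  have hC1 : 1 ≤ C := by omega
  have hbasis (ψ : K →+* ℂ) (j) : ‖ψ (RingOfIntegers.basis K j)‖ ≤ C :=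
    (hC₁ (ψ, j)).trans (hCle _ (by omega))
  have hell (j j') : ‖ell φ μ (RingOfIntegers.basis K j * RingOfIntegers.basis K j')‖ ≤ C :=
    (hC₂ (j, j')).trans (hCle _ (by omega))
  obtain ⟨H, N, hH, hN, hNH, hparam⟩ := exists_parameters hd1 hC1 r
  set L := auxDegree d H N with hL
  have hL1 : 1 ≤ L := Nat.mul_pos (by omega) (pow_pos (by omega) _)
  set M := d ^ 2 * H * L * C * r with hM
  have hD : (δ : ℂ) ^ M ≠ 0 := pow_ne_zero _ (by exact_mod_cast (by omega : δ ≠ 0))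
  have hε' (t : Module.Free.ChooseBasisIndex ℤ (𝓞 K) → Fin H)
      (s : Module.Free.ChooseBasisIndex ℤ (𝓞 K) → Fin L) :=
    hε C (by omega) H L (fun j => t j) (fun j => s j) (fun j => (t j).2) fun j => (s j).2
  choose ε hε₁ hε₂ using hε'
  obtain ⟨p, hp0, hpb, hpz⟩ := exists_auxFun φ μ hμ (by omega) hC1 hH hN hsiegel hbasis hL hD ε
    hε₁ hε₂
  set F := auxFun φ μ p with hF
  have hex : ∃ n, ∃ t : Module.Free.ChooseBasisIndex ℤ (𝓞 K) → Fin H, ∃ τ : Fin n → Gal(K/ℚ),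
      F.value (point φ (boxSum fun j => (t j : ℕ)))
        (∏ l, F.symbol (Pi.single (τ l) 1)) ≠ 0 := by
    obtain ⟨n, τ, h⟩ := exists_value_ne_zero φ μ hμ hp0
    refine ⟨n, fun _ => ⟨0, hH⟩, τ, ?_⟩
    rw [point_boxSum]
    simpa using h
  set T := Nat.find hex with hTdef
  have hTmin := fun n (hn : n < T) => Nat.find_min hex hn
  push Not at hTmin
  obtain ⟨t, τ, hne⟩ : ∃ t : Module.Free.ChooseBasisIndex ℤ (𝓞 K) → Fin H,
      ∃ τ : Fin T → Gal(K/ℚ), F.value (point φ (boxSum fun j => (t j : ℕ)))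
        (∏ l, F.symbol (Pi.single (τ l) 1)) ≠ 0 := Nat.find_spec hex
  have hTN : N ^ (d + 1) ≤ T := by
    by_contra! hlt
    exact hne (hpz t T hlt τ)
  obtain ⟨R, hNR, hR1, hR2⟩ := exists_pow_le_lt d hN hTN
  -- the algebraic number
  have hval := value_auxFun φ μ p hμ (boxSum fun j => (t j : ℕ)) τ (fun i => ε t i.2) _
    fun i => hε₁ t i.2
  set x : 𝓞 K := ∑ i, algEntry i (boxSum fun j => (t j : ℕ)) τ (ε t i.2) * p i with hx
  have hprodne : (∏ l, μ (τ l)) * φ x ≠ 0 := hval ▸ mul_ne_zero hD hne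
  have hx0 : x ≠ 0 := by
    rintro h
    rw [h] at hprodne
    simp at hprodne
  have hxhouse : house (x : K) ≤ L ^ (d + 1) * (coeffBound d C r H N * entryBound d C r H L T) := by
    refine house_le_of_forall_embedding fun ψ => ?_
    rw [hx]
    push_cast
    rw [map_sum]
    refine (norm_sum_le _ _).trans ?_
    calc _ ≤ ∑ _i : Fin L × (Module.Free.ChooseBasisIndex ℤ (𝓞 K) → Fin L),
          coeffBound d C r H N * entryBound d C r H L T := by
          refine Finset.sum_le_sum fun i _ => ?_
          rw [map_mul, norm_mul, mul_comm]
          have h1 := norm_algEntry_le i hC1 hH hL1 hbasis (fun j => (t j).2) τ (ε t i.2) ψ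
            (hε₂ t i.2 ψ)
          rw [Fintype.card_fin] at h1
          have h2 := (norm_embedding_le_house (p i : K) ψ).trans (hpb i)
          exact mul_le_mul h2 h1 (norm_nonneg _) ((norm_nonneg _).trans h2)
      _ = _ := by
          rw [Finset.sum_const, Finset.card_univ, card_index, nsmul_eq_mul]
          push_cast
          rfl
  have hlow := one_le_norm_mul_pow φ hx0 hxhouse
  -- the analytic estimate
  obtain ⟨g, hg⟩ := F.exists_norm_value_le (C := C) hq
    (fun σ j => (hC₄ (σ, j)).trans (hCle _ (by omega))) τ (point φ (boxSum fun j => (t j : ℕ)))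
  rw [hcardJ] at hg
  obtain ⟨j, hj⟩ : ∃ j, T ≤ d * (Finset.univ.filter fun l => g l = j).card := by
    by_contra! hlt
    have h1 := Finset.sum_lt_sum_of_nonempty (Finset.univ_nonempty
      (α := Module.Free.ChooseBasisIndex ℤ (𝓞 K))) fun j _ => hlt j
    rw [← Finset.mul_sum, Finset.sum_const, Finset.card_univ, hcardJ, smul_eq_mul,
      Finset.sum_card_fiberwise_eq_card_filter] at h1
    simp at h1
  set m := (Finset.univ.filter fun l => g l = j).card with hm
  have hmT : m ≤ T := (Finset.card_filter_le _ _).trans (by simp)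
  have hschwarz := F.norm_value_le_of_zeros (y := fun j => point φ (RingOfIntegers.basis K j))
    (H := H) (T := T) (t := fun j => (t j : ℕ)) (R := R) (B := growthBound d C r H N T R)
    (fun t ht n hn Q hQ => ?_) (fun j => (t j).2) g j hm.symm
    (by exact_mod_cast hNH.trans hNR) (fun t ht z hz => ?_)
  rotate_left
  · refine F.value_eq_zero_of_mem_pow (e := fun σ => Pi.single σ 1) ?_ (fun τ => ?_) hQ
    · refine top_unique fun v _ => ?_
      rw [show v = ∑ σ, v σ • Pi.single σ (1 : ℂ) from pi_eq_sum_univ' v |>.trans (by simp)]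
      exact Submodule.sum_mem _ fun σ _ =>
        Submodule.smul_mem _ _ (Submodule.subset_span ⟨σ, rfl⟩)
    · rw [← point_boxSum]
      exact hTmin n hn (fun j => ⟨t j, ht j⟩) τ
  · rw [← point_boxSum, growthBound]
    exact norm_value_auxFun_le φ μ p hC1 hH hL1 hbasis hell
      (fun i => (norm_embedding_le_house (p i : K) φ).trans (hpb i)) ht _ g
      ((Finset.card_filter_le _ _).trans (by simp)) j hz
  rw [← point_boxSum] at hschwarz
  have hup : ‖φ x‖ ≤ C ^ T * C ^ M * (d * C) ^ T *
      (m.factorial * ((4 * H) ^ (m * H) * growthBound d C r H N T R / R ^ (m * H))) := by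
    have hφx : φ x = (∏ l, (μ (τ l))⁻¹) * ((δ : ℂ) ^ M *
        F.value (point φ (boxSum fun j => (t j : ℕ))) (∏ l, F.symbol (Pi.single (τ l) 1))) := by
      rw [hval, ← mul_assoc, ← Finset.prod_mul_distrib]
      rw [Finset.prod_congr rfl fun l _ => inv_mul_cancel₀ ?_]
      · simp
      · exact fun h0 => hprodne (by rw [Finset.prod_eq_zero (Finset.mem_univ l) h0, zero_mul])
    rw [hφx, norm_mul, norm_mul, norm_prod, norm_pow, RCLike.norm_natCast, mul_assoc, mul_assoc]
    have h1 : ∏ l, ‖(μ (τ l))⁻¹‖ ≤ (C : ℝ) ^ T := by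
      calc ∏ l, ‖(μ (τ l))⁻¹‖ ≤ ∏ _l : Fin T, (C : ℝ) :=
            Finset.prod_le_prod (fun _ _ => norm_nonneg _)
              fun l _ => (hC₃ (τ l)).trans (hCle _ (by omega))
        _ = _ := by simp
    have h2 : (δ : ℝ) ≤ C := hCle _ (by omega)
    gcongr
    exact hg.trans (by gcongr)
  have := hparam T R m hNR hR1 hR2 hj hmT
  refine absurd this (not_lt.2 (hlow.trans ?_))
  have h0 : 0 ≤ (L : ℝ) ^ (d + 1) * (coeffBound d C r H N * entryBound d C r H L T) :=
    (house_nonneg _).trans hxhouse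
  gcongr

theorem norm_trace_boxSum_mul_le {K : Type*} [Field K] [NumberField K] {c : 𝓞 K} {C : ℝ}
    (hC : ∀ j k, ‖Algebra.trace ℤ (𝓞 K)
      (RingOfIntegers.basis K j * RingOfIntegers.basis K k * c)‖ ≤ C)
    {H L : ℕ} {t s : Module.Free.ChooseBasisIndex ℤ (𝓞 K) → ℕ}
    (ht : ∀ j, t j < H) (hs : ∀ j, s j < L) :
    ‖Algebra.trace ℤ (𝓞 K) (boxSum t * boxSum s * c)‖ ≤
      Module.finrank ℚ K * H * (Module.finrank ℚ K * L * C) := by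
  have h := norm_boxSum_le ht ((Algebra.trace ℤ (𝓞 K)).toAddMonoidHom.comp
    (AddMonoidHom.mulRight (boxSum s * c))) (C := Module.finrank ℚ K * L * C) fun j => by
      have h := norm_boxSum_le hs ((Algebra.trace ℤ (𝓞 K)).toAddMonoidHom.comp
        ((AddMonoidHom.mulRight c).comp (AddMonoidHom.mulLeft (RingOfIntegers.basis K j))))
        (hC j)
      simpa [mul_assoc] using h
  simpa [mul_assoc] using h

theorem ell_eq_sum_trace {K : Type*} [Field K] [NumberField K] [IsGalois ℚ K] (φ : K →+* ℂ)
    {ι : Type*} [Fintype ι] (c : ι → 𝓞 K) (l : ι → ℂ) (x : 𝓞 K) :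
    ell φ (fun σ => ∑ i, φ (σ (c i)) * l i) x =
      ∑ i, (Algebra.trace ℤ (𝓞 K) (x * c i) : ℂ) * l i := by
  have h (i : ι) : (Algebra.trace ℤ (𝓞 K) (x * c i) : ℂ) =
      ∑ σ : Gal(K/ℚ), φ (σ (c i)) * φ (σ x) := by
    have h1 := Algebra.coe_trace_int (K := K) (x * c i)
    have h2 := trace_eq_sum_automorphisms (K := ℚ) ((x * c i : 𝓞 K) : K)
    rw [← h1] at h2
    have h3 := congrArg φ h2
    simpa [mul_comm] using h3
  simp_rw [h, Finset.sum_mul]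
  rw [Finset.sum_comm]
  simp only [ell, AddMonoidHom.coe_mk, ZeroHom.coe_mk, Finset.sum_mul]
  exact Finset.sum_congr rfl fun σ _ => Finset.sum_congr rfl fun i _ => by ring

end AuxFun

/-- In a Galois number field, a linear form with integral coefficients in logarithms of elements
of the field does not take the value `1`. -/
theorem sum_mul_ne_one_of_isGalois {K : Type} [Field K] [NumberField K] [IsGalois ℚ K]
    (φ : K →+* ℂ) {ι : Type*} [Fintype ι] (c : ι → 𝓞 K) (α : ι → K) (l : ι → ℂ)
    (hα : ∀ i, φ (α i) = Complex.exp (l i)) : ∑ i, φ (c i) * l i ≠ 1 := by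
  intro h1
  obtain ⟨δ, C₀, hδ, hC₀⟩ := exists_denominator_monomials α
  obtain ⟨C₁, hC₁⟩ := exists_nat_forall_le
    fun p : ι × Module.Free.ChooseBasisIndex ℤ (𝓞 K) × Module.Free.ChooseBasisIndex ℤ (𝓞 K) =>
      ‖Algebra.trace ℤ (𝓞 K)
        (RingOfIntegers.basis K p.2.1 * RingOfIntegers.basis K p.2.2 * c p.1)‖
  refine AuxFun.not_exists_denominators φ (fun σ => ∑ i, φ (σ (c i)) * l i) (by simpa using h1)
    (r := Fintype.card ι) (C₀ := C₀ + C₁) hδ fun C hC H L t s ht hs => ?_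
  obtain ⟨ε, hε, hε'⟩ := hC₀ C (by omega) (Module.finrank ℚ K ^ 2 * H * L * C)
    (fun i => Algebra.trace ℤ (𝓞 K) (AuxFun.boxSum t * AuxFun.boxSum s * c i)) fun i => by
      have h := AuxFun.norm_trace_boxSum_mul_le (c := c i) (C := C)
        (fun j k => (hC₁ (i, j, k)).trans (by exact_mod_cast (by omega))) ht hs
      rw [Int.norm_eq_abs] at h
      have h' : ((|Algebra.trace ℤ (𝓞 K) (AuxFun.boxSum t * AuxFun.boxSum s * c i)| : ℤ) : ℝ) ≤
          ((Module.finrank ℚ K ^ 2 * H * L * C : ℕ) : ℝ) := by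
        push_cast
        exact h.trans (le_of_eq (by ring))
      exact_mod_cast h'
  refine ⟨ε, ?_, hε'⟩
  rw [hε, AuxFun.ell_eq_sum_trace, Complex.exp_sum]
  simp [Complex.exp_int_mul, hα]

/-- A linear form with algebraic coefficients in logarithms of algebraic numbers which takes an
algebraic value vanishes. -/
theorem sum_mul_eq_zero_of_isAlgebraic {ι : Type*} [Fintype ι] (b l : ι → ℂ)
    (hb : ∀ i, IsAlgebraic ℚ (b i)) (hl : ∀ i, IsAlgebraic ℚ (Complex.exp (l i)))
    (h : IsAlgebraic ℚ (∑ i, b i * l i)) : ∑ i, b i * l i = 0 := by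
  classical
  by_contra h0
  set Λ := ∑ i, b i * l i with hΛ
  have hb' (i : ι) : IsAlgebraic ℤ (b i * Λ⁻¹) :=
    (IsFractionRing.isAlgebraic_iff ℤ ℚ ℂ).mpr ((hb i).mul h.inv)
  have hden : ∃ D : ℤ, D ≠ 0 ∧ ∀ i, IsIntegral ℤ (D • (b i * Λ⁻¹)) := by
    choose r hr hri using fun i => (hb' i).exists_integral_multiple
    refine ⟨∏ i, r i, Finset.prod_ne_zero_iff.mpr fun i _ => hr i, fun i => ?_⟩
    rw [← Finset.prod_erase_mul _ _ (Finset.mem_univ i), mul_smul]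
    exact (hri i).smul _
  obtain ⟨D, hD, hDi⟩ := hden
  have hD' : (D : ℂ) ≠ 0 := by exact_mod_cast hD
  have hl' (i : ι) : IsAlgebraic ℚ (Complex.exp (l i / D)) := by
    refine IsAlgebraic.of_pow (Int.natAbs_pos.mpr hD) ?_
    rw [← Complex.exp_nat_mul]
    rcases Int.natAbs_eq D with h | h
    · have : (D.natAbs : ℂ) = D := by rw [h]; simp
      rw [this, mul_div_cancel₀ _ hD']
      exact hl i
    · have : (D.natAbs : ℂ) = -D := by rw [h]; simp
      rw [this, neg_mul, mul_div_cancel₀ _ hD', Complex.exp_neg]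
      exact (hl i).inv
  let S : Set ℂ := Set.range (fun i => Complex.exp (l i / D)) ∪ Set.range fun i => b i * Λ⁻¹
  have hS : ∀ x ∈ S, IsIntegral ℚ x := by
    rintro x (⟨i, rfl⟩ | ⟨i, rfl⟩)
    · exact (hl' i).isIntegral
    · exact ((hb i).mul h.inv).isIntegral
  have : Finite S := Set.Finite.to_subtype ((Set.finite_range _).union (Set.finite_range _))
  have := IntermediateField.finiteDimensional_adjoin hS
  let K := IntermediateField.normalClosure ℚ (IntermediateField.adjoin ℚ S) ℂ
  have hSK : ∀ x ∈ S, x ∈ K := fun x hx =>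
    IntermediateField.le_normalClosure _ (IntermediateField.subset_adjoin ℚ S hx)
  have : FiniteDimensional ℚ K := inferInstance
  have : NumberField K := ⟨⟩
  have := (Algebra.IsAlgebraic.of_finite ℚ (IntermediateField.adjoin ℚ S)
    |>.isNormalClosure_normalClosure (L := ℂ) fun x => IsAlgClosed.splits _)
  have : Normal ℚ K := this.normal
  have : IsGalois ℚ K := ⟨⟩
  refine sum_mul_ne_one_of_isGalois (K := K) (algebraMap K ℂ)
    (fun i => ⟨⟨D • (b i * Λ⁻¹), zsmul_mem (hSK _ (Or.inr ⟨i, rfl⟩)) D⟩, ?_⟩)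
    (fun i => ⟨_, hSK _ (Or.inl ⟨i, rfl⟩)⟩) (fun i => l i / D) (fun i => rfl) ?_
  · exact (isIntegral_algebraMap_iff (algebraMap K ℂ).injective).mp (hDi i)
  · have : ∀ i, (D • (b i * Λ⁻¹)) * (l i / D) = b i * l i * Λ⁻¹ := fun i => by
      rw [zsmul_eq_mul]; field_simp
    calc _ = ∑ i, (D • (b i * Λ⁻¹)) * (l i / D) := rfl
      _ = 1 := by simp_rw [this]; rw [← Finset.sum_mul, ← hΛ, mul_inv_cancel₀ h0]

open Filter Topology

theorem tendsto_sum_digamma {x : ℝ} (hx : 0 < x) :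
    Tendsto (fun N : ℕ => ∑ k ∈ Finset.range N, (1 / ((k : ℝ) + 1) - 1 / ((k : ℝ) + x))) atTop
      (𝓝 (digamma x + Real.eulerMascheroniConstant)) := by
  have hs : Summable fun k : ℕ => 1 / ((k : ℝ) + 1) - 1 / (((k : ℝ) + 1) + x) := by
    have h2 : Summable fun k : ℕ => x * (1 / ((k + 1 : ℕ) : ℝ) ^ 2) :=
      ((summable_nat_add_iff 1).mpr (Real.summable_one_div_nat_pow.mpr one_lt_two)).mul_left x
    refine h2.of_nonneg_of_le (fun k => ?_) fun k => ?_
    · rw [sub_nonneg]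
      exact one_div_le_one_div_of_le (by positivity) (by linarith)
    · push_cast
      rw [div_sub_div _ _ (by positivity) (by positivity), ← mul_div_assoc,
        div_le_div_iff₀ (by positivity) (by positivity)]
      have : (0 : ℝ) ≤ k := k.cast_nonneg
      nlinarith [mul_nonneg (mul_nonneg hx.le hx.le) (by positivity : (0 : ℝ) ≤ (k : ℝ) + 1)]
  have heq (N : ℕ) : ∑ k ∈ Finset.range N, (1 / ((k : ℝ) + 1) - 1 / ((k : ℝ) + x)) =
      ∑ k ∈ Finset.range N, (1 / ((k : ℝ) + 1) - 1 / (((k : ℝ) + 1) + x)) - 1 / x +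
        1 / ((N : ℝ) + x) := by
    induction N with
    | zero => simp
    | succ N ih =>
      rw [Finset.sum_range_succ, ih, Finset.sum_range_succ]
      push_cast
      ring
  have hz : Tendsto (fun N : ℕ => 1 / ((N : ℝ) + x)) atTop (𝓝 0) :=
    tendsto_const_nhds.div_atTop (tendsto_atTop_add_const_right _ _ tendsto_natCast_atTop_atTop)
  simp_rw [heq]
  convert (hs.hasSum.tendsto_sum_nat.sub_const (1 / x)).add hz using 2
  rw [digamma]
  ring

theorem digamma_one : digamma 1 = -Real.eulerMascheroniConstant := by
  have h := tendsto_sum_digamma one_pos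
  simp only [sub_self, Finset.sum_const_zero] at h
  linarith [tendsto_nhds_unique h tendsto_const_nhds]

theorem digamma_lt_of_lt_one {x : ℝ} (hx : 0 < x) (hx1 : x < 1) :
    digamma x < -Real.eulerMascheroniConstant := by
  have hneg (k : ℕ) : 1 / ((k : ℝ) + 1) - 1 / ((k : ℝ) + x) < 0 := by
    rw [sub_neg]
    exact one_div_lt_one_div_of_lt (by positivity) (by linarith)
  have h : digamma x + Real.eulerMascheroniConstant ≤
      1 / (((0 : ℕ) : ℝ) + 1) - 1 / (((0 : ℕ) : ℝ) + x) := by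
    refine le_of_tendsto (tendsto_sum_digamma hx) ?_
    filter_upwards [eventually_ge_atTop 1] with N hN
    obtain ⟨N, rfl⟩ := Nat.exists_eq_add_of_le' hN
    rw [Finset.sum_range_succ']
    linarith [Finset.sum_nonpos fun k (_ : k ∈ Finset.range N) => (hneg (k + 1)).le]
  linarith [hneg 0]

theorem tendsto_sum_pow_div_neg_log {z : ℂ} (hz : ‖z‖ = 1) (hz1 : z ≠ 1) :
    Tendsto (fun N : ℕ => ∑ m ∈ Finset.range N, z ^ (m + 1) / ((m : ℂ) + 1)) atTop
      (𝓝 (-Complex.log (1 - z))) := by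
  have hz1' : z - 1 ≠ 0 := sub_ne_zero.mpr hz1
  have hc : CauchySeq fun N : ℕ => ∑ m ∈ Finset.range N, z ^ (m + 1) / ((m : ℂ) + 1) := by
    have h := Antitone.cauchySeq_series_mul_of_tendsto_zero_of_bounded
      (f := fun m : ℕ => 1 / ((m : ℝ) + 1)) (z := fun m : ℕ => z ^ (m + 1)) (b := 2 / ‖z - 1‖)
      (fun a b hab => by
        have : (a : ℝ) ≤ b := by exact_mod_cast hab
        exact one_div_le_one_div_of_le (by positivity) (by linarith))
      tendsto_one_div_add_atTop_nhds_zero_nat fun N => by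
        simp_rw [pow_succ]
        rw [← Finset.sum_mul, geom_sum_eq hz1, norm_mul, hz, mul_one, norm_div]
        gcongr
        refine (norm_sub_le _ _).trans ?_
        rw [norm_pow, hz]
        norm_num
    simpa [div_eq_inv_mul] using h
  obtain ⟨l, hl⟩ := cauchySeq_tendsto_of_complete hc
  have h1 : Tendsto (fun x : ℝ => (x : ℂ) * ∑' m : ℕ, z ^ (m + 1) / ((m : ℂ) + 1) * (x : ℂ) ^ m)
      (𝓝[<] 1) (𝓝 (1 * l)) :=
    ((Complex.continuous_ofReal.tendsto' 1 1 Complex.ofReal_one).mono_left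
      nhdsWithin_le_nhds).mul
      (tendsto_map'_iff.mp (Complex.tendsto_tsum_powerSeries_nhdsWithin_lt hl))
  have hmem : 1 - z ∈ Complex.slitPlane := by
    refine Or.inl ?_
    have hre : z.re ≤ 1 := hz ▸ Complex.re_le_norm z
    rcases hre.lt_or_eq with h | h
    · simpa using h
    · refine absurd (Complex.ext h ?_) hz1
      have := Complex.sq_norm z
      rw [hz, Complex.normSq_apply, h] at this
      simpa using this
  have h2 : Tendsto (fun x : ℝ => -Complex.log (1 - z * x)) (𝓝[<] 1)
      (𝓝 (-Complex.log (1 - z * (1 : ℝ)))) := by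
    refine Tendsto.neg (Tendsto.clog ?_ (by simpa using hmem))
    exact (Continuous.tendsto (by fun_prop) _).mono_left nhdsWithin_le_nhds
  have h3 : l = -Complex.log (1 - z) := by
    have := tendsto_nhds_unique_of_eventuallyEq h1 h2 ?_
    · simpa using this
    · filter_upwards [Ioo_mem_nhdsLT (show (0 : ℝ) < 1 by norm_num)] with x hx
      have hzx : ‖z * x‖ < 1 := by
        rw [norm_mul, hz, one_mul, Complex.norm_real, Real.norm_of_nonneg hx.1.le]
        exact hx.2
      rw [← (Complex.hasSum_taylorSeries_neg_log' hzx).tsum_eq, ← tsum_mul_left]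
      exact tsum_congr fun m => by ring
  exact h3 ▸ hl

theorem IsPrimitiveRoot.sum_pow_mul {n : ℕ} {ζ : ℂ} (hζ : IsPrimitiveRoot ζ n)
    (a : ℕ) : ∑ j ∈ Finset.range n, (ζ ^ j) ^ a = if n ∣ a then (n : ℂ) else 0 := by
  simp_rw [← pow_mul, mul_comm _ a, pow_mul]
  split_ifs with h
  · simp [(hζ.pow_eq_one_iff_dvd a).mpr h]
  · rw [geom_sum_eq (mt (hζ.pow_eq_one_iff_dvd a).mp h), ← pow_mul, mul_comm, pow_mul,
      hζ.pow_eq_one]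
    simp

theorem sum_block_div {n s : ℕ} (hs : 1 ≤ s) (hsn : s ≤ n) {ζ : ℂ} (hζ : IsPrimitiveRoot ζ n)
    (M : ℕ) :
    ∑ m ∈ Finset.range (n * M), ∑ j ∈ Finset.range n,
      (ζ ^ j) ^ (n - s) * ((ζ ^ j) ^ (m + 1) / ((m : ℂ) + 1)) =
    ∑ k ∈ Finset.range M, 1 / ((k : ℂ) + s / n) := by
  have hn : 0 < n := by omega
  have hn' : (n : ℂ) ≠ 0 := by exact_mod_cast hn.ne'
  have inner (m : ℕ) : ∑ j ∈ Finset.range n,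
      (ζ ^ j) ^ (n - s) * ((ζ ^ j) ^ (m + 1) / ((m : ℂ) + 1)) =
      (if n ∣ n - s + (m + 1) then (n : ℂ) else 0) / ((m : ℂ) + 1) := by
    rw [← hζ.sum_pow_mul, Finset.sum_div]
    exact Finset.sum_congr rfl fun j _ => by ring
  simp_rw [inner]
  induction M with
  | zero => simp
  | succ M ih =>
    rw [Nat.mul_succ, Finset.sum_range_add, ih, Finset.sum_range_succ]
    congr 1
    rw [Finset.sum_eq_single_of_mem (s - 1) (Finset.mem_range.mpr (by omega))]
    · have hd : n - s + (n * M + (s - 1) + 1) = n * (M + 1) := by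
        rw [Nat.mul_succ]
        omega
      rw [hd, if_pos (dvd_mul_right _ _)]
      push_cast [hs]
      field_simp
      ring
    · intro i hi hne
      rw [if_neg, zero_div]
      rw [Finset.mem_range] at hi
      rw [show n - s + (n * M + i + 1) = n - s + (i + 1) + n * M by ring,
        Nat.dvd_add_left (dvd_mul_right _ _)]
      rintro ⟨q, hq⟩
      rcases q with _ | _ | q
      · omega
      · omega
      · have : n * (q + 1 + 1) = n * q + n + n := by ring
        omega

/-- A difference of values of the digamma function at rational points is a linear form in
logarithms of algebraic numbers. -/
theorem digamma_sub_digamma {n r s : ℕ} (hr : 1 ≤ r) (hrn : r ≤ n) (hs : 1 ≤ s) (hsn : s ≤ n)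
    {ζ : ℂ} (hζ : IsPrimitiveRoot ζ n) :
    ((digamma ((r : ℝ) / n) - digamma ((s : ℝ) / n) : ℝ) : ℂ) =
      ∑ j ∈ Finset.range n,
        ((ζ ^ j) ^ (n - s) - (ζ ^ j) ^ (n - r)) * -Complex.log (1 - ζ ^ j) := by
  have hn : 0 < n := by omega
  have hn' : (0 : ℝ) < n := by exact_mod_cast hn
  have hr' : (0 : ℝ) < r := by exact_mod_cast hr
  have hs' : (0 : ℝ) < s := by exact_mod_cast hs
  have hζn : ‖ζ‖ = 1 := hζ.norm'_eq_one hn.ne'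
  have h1 : Tendsto (fun N : ℕ => ∑ m ∈ Finset.range N, ∑ j ∈ Finset.range n,
      ((ζ ^ j) ^ (n - s) - (ζ ^ j) ^ (n - r)) * ((ζ ^ j) ^ (m + 1) / ((m : ℂ) + 1))) atTop
      (𝓝 (∑ j ∈ Finset.range n,
        ((ζ ^ j) ^ (n - s) - (ζ ^ j) ^ (n - r)) * -Complex.log (1 - ζ ^ j))) := by
    simp_rw [Finset.sum_comm (s := Finset.range _) (t := Finset.range n), ← Finset.mul_sum]
    refine tendsto_finsetSum _ fun j hj => ?_
    rcases Nat.eq_zero_or_pos j with rfl | hj0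
    · simp
    · refine (tendsto_sum_pow_div_neg_log (by rw [norm_pow, hζn, one_pow]) ?_).const_mul _
      exact hζ.pow_ne_one_of_pos_of_lt hj0.ne' (Finset.mem_range.mp hj)
  have h2 := h1.comp (tendsto_id.const_mul_atTop' hn)
  have h3 := (Complex.continuous_ofReal.tendsto _).comp
    ((tendsto_sum_digamma (div_pos hr' hn')).sub (tendsto_sum_digamma (div_pos hs' hn')))
  refine tendsto_nhds_unique (by simpa using h3) (h2.congr fun M => ?_)
  simp only [Function.comp_apply, id, sub_mul, Finset.sum_sub_distrib]
  rw [sum_block_div hs hsn hζ, sum_block_div hr hrn hζ]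
  push_cast
  simp

/-- If the difference of two digamma values at fractions with a common denominator is algebraic,
it vanishes. -/
theorem digamma_eq_of_isAlgebraic_sub {n r s : ℕ} (hr : 1 ≤ r) (hrn : r ≤ n) (hs : 1 ≤ s)
    (hsn : s ≤ n) (h : IsAlgebraic ℚ (digamma ((r : ℝ) / n) - digamma ((s : ℝ) / n))) :
    digamma ((r : ℝ) / n) = digamma ((s : ℝ) / n) := by
  have hn : n ≠ 0 := by omega
  have hζ := Complex.isPrimitiveRoot_exp n hn
  set ζ := Complex.exp (2 * Real.pi * Complex.I / n)
  have hζa : IsAlgebraic ℚ ζ := (hζ.isIntegral (Nat.pos_of_ne_zero hn)).tower_top.isAlgebraic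
  have hD := digamma_sub_digamma hr hrn hs hsn hζ
  have hA := h.algebraMap (A := ℂ)
  rw [Complex.coe_algebraMap, hD, Finset.sum_range] at hA
  have h0 := sum_mul_eq_zero_of_isAlgebraic _ _
    (fun j => (((hζa.pow _).pow _).sub ((hζa.pow _).pow _))) (fun j => ?_) hA
  · rw [Finset.sum_range, h0] at hD
    exact sub_eq_zero.mp (by exact_mod_cast hD)
  · by_cases hj : 1 - ζ ^ (j : ℕ) = 0
    · simpa [hj] using isAlgebraic_one
    · rw [Complex.exp_neg, Complex.exp_log hj]
      exact (isAlgebraic_one.sub (hζa.pow _)).inv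

/-- For any integer `n > 1`, at most one member of
`{γ} ∪ {ψ(r/n) : 1 ≤ r ≤ n, gcd(r,n) = 1}` is algebraic. -/
theorem at_most_one_algebraic_digamma (n : ℕ) (hn : 1 < n) :
    ¬ ∃ x y : ℝ, x ∈ digammaSet n ∧ y ∈ digammaSet n ∧ x ≠ y ∧
      IsAlgebraic ℚ x ∧ IsAlgebraic ℚ y := by
  have hn0 : (0 : ℝ) < n := by exact_mod_cast (by omega : 0 < n)
  have mixed (r : ℕ) (hr : 1 ≤ r) (hrn : r ≤ n) (hg : Nat.gcd r n = 1)
      (h1 : IsAlgebraic ℚ (digamma ((r : ℝ) / n)))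
      (h2 : IsAlgebraic ℚ Real.eulerMascheroniConstant) : False := by
    have hlt : r < n := lt_of_le_of_ne hrn (by rintro rfl; simp at hg; omega)
    have hone : digamma ((n : ℝ) / n) = -Real.eulerMascheroniConstant := by
      rw [div_self hn0.ne', digamma_one]
    have h := digamma_eq_of_isAlgebraic_sub hr hrn hn.le le_rfl (by
      rw [hone]
      exact h1.sub h2.neg)
    refine (digamma_lt_of_lt_one (x := (r : ℝ) / n) (div_pos (by exact_mod_cast hr) hn0) ?_).ne
      (h.trans hone)
    rw [div_lt_one hn0]
    exact_mod_cast hlt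
  rintro ⟨x, y, hx | ⟨r, hr, hrn, hrg, rfl⟩, hy | ⟨s, hs, hsn, hsg, rfl⟩, hxy, hxa, hya⟩
  · exact hxy (hx.trans hy.symm)
  · exact mixed s hs hsn hsg hya (Set.mem_singleton_iff.mp hx ▸ hxa)
  · exact mixed r hr hrn hrg hxa (Set.mem_singleton_iff.mp hy ▸ hya)
  · exact hxy (digamma_eq_of_isAlgebraic_sub hr hrn hs hsn (hxa.sub hya))
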